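/- arXiv:2508.20797 — 2 statements merged into one kernel-verified Lean document; each statement's English description precedes it below -/
import Mathlib

section
/- Let l ≥ 1 be an integer and let μ denote the normalized Haar probability measure on the unitary group U(l) of l×l complex unitary matrices. Then for every real z, ∫_{U(l)} exp(z · Tr(U + U†)) dμ(U) = det[ I_{j−k}(2z) ]_{j,k=1,…,l}. -/
open Real MeasureTheory Matrix

/-- Modified Bessel function of the first kind,
`I_ν(x) := Σ_{k=0}^∞ (x/2)^{ν+2k}/(k! Γ(ν+k+1))`. -/
noncomputable def besselI (ν : ℝ) (x : ℝ) : ℝ :=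
  ∑' k : ℕ, (x / 2) ^ (ν + 2 * (k : ℝ)) / ((k.factorial : ℝ) * Real.Gamma (ν + (k : ℝ) + 1))

/-- The (product) measurable structure on matrices. -/
instance matrixMeasurableSpace (m n α : Type*) [MeasurableSpace α] :
    MeasurableSpace (Matrix m n α) :=
  inferInstanceAs (MeasurableSpace (m → n → α))

set_option linter.unusedSimpArgs false
set_option linter.unusedSectionVars false

section Alg
variable {R : Type*} [CommRing R] [Algebra ℂ R]

theorem drv_prod {ι : Type*} [DecidableEq ι] (D : Derivation ℂ R R) (s : Finset ι) (f : ι → R) :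
    D (∏ i ∈ s, f i) = ∑ i ∈ s, (∏ j ∈ s.erase i, f j) * D (f i) := by
  induction s using Finset.induction_on with
  | empty => simp
  | insert a s ha ih =>
    rw [Finset.prod_insert ha, Derivation.leibniz, ih, Finset.sum_insert ha, Finset.erase_insert ha,
      smul_eq_mul, smul_eq_mul, add_comm, Finset.mul_sum]
    congr 1
    refine Finset.sum_congr rfl fun i hi => ?_
    have hne : a ≠ i := fun h => ha (h ▸ hi)
    rw [Finset.erase_insert_of_ne hne, Finset.prod_insert (by simp [ha])]
    ring

theorem drv_mul {n : Type*} [Fintype n] (D : Derivation ℂ R R) (M N : Matrix n n R) :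
    (M * N).map D = M.map D * N + M * N.map D := by
  ext i j
  simp only [Matrix.map_apply, Matrix.mul_apply, map_sum, Derivation.leibniz, Matrix.add_apply,
    smul_eq_mul, Finset.sum_add_distrib]
  rw [add_comm]
  congr 1
  exact Finset.sum_congr rfl fun _ _ => mul_comm _ _

theorem drv_det {n : Type*} [Fintype n] [DecidableEq n] (D : Derivation ℂ R R) (Y : Matrix n n R) :
    D Y.det = (Y.adjugate * Y.map D).trace := by
  have h1 : (Y.adjugate * Y.map D).trace = ∑ i, (Y.updateCol i (fun j => D (Y j i))).det := by
    simp only [Matrix.trace, Matrix.diag]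
    refine Finset.sum_congr rfl fun i _ => ?_
    rw [← Matrix.cramer_apply, Matrix.cramer_eq_adjugate_mulVec]
    rfl
  rw [h1, Matrix.det_apply]
  simp only [Matrix.det_apply, map_sum]
  rw [Finset.sum_comm]
  refine Finset.sum_congr rfl fun σ _ => ?_
  rw [Units.smul_def, map_zsmul, drv_prod, Finset.smul_sum]
  refine Finset.sum_congr rfl fun i _ => ?_
  rw [Units.smul_def]
  congr 1
  rw [← Finset.mul_prod_erase _ _ (Finset.mem_univ i), mul_comm]
  congr 1
  · simp
  · refine Finset.prod_congr rfl fun j hj => ?_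
    rw [Matrix.updateCol_ne (Finset.ne_of_mem_erase hj)]

theorem drv_adj {n : Type*} [Fintype n] [DecidableEq n] (D : Derivation ℂ R R) (Y : Matrix n n R) :
    Y.det • Y.adjugate.map D = D Y.det • Y.adjugate - Y.adjugate * Y.map D * Y.adjugate := by
  have h := drv_mul D Y.adjugate Y
  rw [Matrix.adjugate_mul] at h
  have h2 : (Y.det • (1 : Matrix n n R)).map D = D Y.det • 1 := by
    ext i j
    by_cases hij : i = j <;> simp [Matrix.one_apply, hij]
  rw [h2] at h
  have h3 := congrArg (· * Y.adjugate) h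
  simp only [Matrix.add_mul, Matrix.mul_assoc, Matrix.mul_adjugate, Matrix.smul_mul, Matrix.one_mul,
    Matrix.mul_smul, Matrix.mul_one] at h3
  rw [h3, Matrix.mul_assoc]; abel

end Alg

section Cas
variable {R : Type*} [CommRing R] [IsDomain R] [Algebra ℂ R] {l : ℕ}

/-- first-order formulas -/
theorem cas_first (X : Matrix (Fin l) (Fin l) R) (b : R) (D : Derivation ℂ R R) (i j : Fin l)
    (hX : X.map D = Matrix.single i j 1 * X) (hb : D b = 0) :
    D (X - b • 1).det = (X * (X - b • 1).adjugate) j i := by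
  have hY : (X - b • (1 : Matrix (Fin l) (Fin l) R)).map D = Matrix.single i j 1 * X := by
    rw [← hX]
    ext p q
    by_cases h : p = q <;> simp [Matrix.one_apply, h, hb]
  rw [drv_det, hY, ← Matrix.mul_assoc, Matrix.trace_mul_comm, ← Matrix.mul_assoc,
    Matrix.trace_mul_comm, Matrix.trace_single_mul]
  simp

theorem N_eq (X : Matrix (Fin l) (Fin l) R) (b : R) :
    X * (X - b • 1).adjugate = (X - b • 1).det • 1 + b • (X - b • 1).adjugate := by
  have : X = (X - b • 1) + b • 1 := by abel
  conv_lhs => rw [this]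
  rw [Matrix.add_mul, ← this, Matrix.mul_adjugate]
  simp

theorem th_first (X : Matrix (Fin l) (Fin l) R) (b : R) (θ : Derivation ℂ R R)
    (hX : X.map θ = 0) (hb : θ b = b) :
    θ (X - b • 1).det = (l : R) * (X - b • 1).det - (X * (X - b • 1).adjugate).trace := by
  have hY : (X - b • (1 : Matrix (Fin l) (Fin l) R)).map θ = - b • (1 : Matrix (Fin l) (Fin l) R) := by
    ext p q
    have := congrFun (congrFun hX p) q
    simp only [Matrix.map_apply, Matrix.zero_apply] at this
    by_cases h : p = q <;> simp [Matrix.one_apply, h, hb, this]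
    subst h; exact this
  rw [drv_det, hY, N_eq]
  simp
  ring

theorem cas_second (X : Matrix (Fin l) (Fin l) R) (b : R) (D : Fin l → Fin l → Derivation ℂ R R)
    (θ : Derivation ℂ R R)
    (hX : ∀ i j, X.map (D i j) = Matrix.single i j 1 * X) (hb : ∀ i j, D i j b = 0)
    (hXθ : X.map θ = 0) (hbθ : θ b = b) (h0 : (X - b • 1).det ≠ 0) :
    ∑ i, ∑ j, D i j ((X * (X - b • 1).adjugate) i j) =
      (l : R) * (X - b • 1).det + ((l : R) - 1) * θ (X - b • 1).det - θ (θ (X - b • 1).det) := by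
  set φ := (X - b • 1).det with hφ
  set A := (X - b • 1).adjugate with hA
  set N := X * A with hN
  have hNe : N = φ • 1 + b • A := N_eq X b
  have hθ1 : θ φ = (l : R) * φ - N.trace := th_first X b θ hXθ hbθ
  have hY : ∀ i j, (X - b • (1 : Matrix (Fin l) (Fin l) R)).map (D i j) = Matrix.single i j 1 * X := by
    intro i j
    rw [← hX]
    ext p q
    by_cases h : p = q <;> simp [Matrix.one_apply, h, hb]
  have hYθ : (X - b • (1 : Matrix (Fin l) (Fin l) R)).map θ = - b • (1 : Matrix (Fin l) (Fin l) R) := by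
    ext p q
    have := congrFun (congrFun hXθ p) q
    simp only [Matrix.map_apply, Matrix.zero_apply] at this
    by_cases h : p = q <;> simp [Matrix.one_apply, h, hbθ, this]
    subst h; exact this
  have hAD : ∀ i j, φ • A.map (D i j) = N j i • A - A * Matrix.single i j 1 * N := by
    intro i j
    rw [drv_adj, hY, ← hφ, ← hA, cas_first X b (D i j) i j (hX i j) (hb i j), ← hA, ← hN, hN]
    simp only [Matrix.mul_assoc]
  have hAθ : φ • A.map θ = θ φ • A + b • (A * A) := by
    rw [drv_adj, hYθ, ← hφ, ← hA]
    simp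
  have htA : b * A.trace = N.trace - l * φ := by
    rw [hNe]; simp; ring
  have htNA : b * (N * A).trace = (N * N).trace - φ * N.trace := by
    have : N * N = φ • N + b • (N * A) := by
      have hc : A * N = N * A := by rw [hNe, Matrix.add_mul, Matrix.mul_add]; simp
      nth_rewrite 1 [hNe]
      rw [Matrix.add_mul]
      simp only [Matrix.smul_mul, Matrix.one_mul, hc]
    rw [this]; simp
  have htAA : b * b * (A * A).trace = (N * N).trace - 2 * φ * N.trace + l * φ ^ 2 := by
    have : N * A = φ • A + b • (A * A) := by
      conv_lhs => rw [hNe]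
      rw [Matrix.add_mul]; simp
    have h2 : b * (b * (A * A).trace) = b * (N * A).trace - φ * (b * A.trace) := by
      rw [this]; simp; ring
    rw [mul_assoc, h2, htNA, htA]; ring
  apply mul_left_cancel₀ h0
  have hL : φ * ∑ i, ∑ j, D i j (N i j) =
      φ * N.trace + b * (N * A).trace - b * A.trace * N.trace := by
    have e : ∀ i j, φ * D i j (N i j) = φ * (if i = j then N j i else 0) + b * (N j i * A i j) -
        b * (A i i * N j j) := by
      intro i j
      have e1 : D i j (N i j) = (if i = j then N j i else 0) + b * D i j (A i j) := by
        rw [hNe]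
        have hφD : D i j φ = N j i := cas_first X b (D i j) i j (hX i j) (hb i j)
        by_cases h : i = j
        · subst h
          simp only [Matrix.add_apply, Matrix.smul_apply, Matrix.one_apply_eq, smul_eq_mul, mul_one,
            map_add, Derivation.leibniz, hb, if_true, hφD]
          simp [hNe]
        · simp only [Matrix.add_apply, Matrix.smul_apply, Matrix.one_apply_ne h, smul_eq_mul,
            mul_zero, map_add, Derivation.leibniz, hb, h, if_false, map_zero]
          simp
      have e2 := congrFun (congrFun (hAD i j) i) j
      simp only [Matrix.smul_apply, Matrix.map_apply, Matrix.sub_apply, smul_eq_mul] at e2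
      have e3 : (A * Matrix.single i j (1 : R) * N : Matrix (Fin l) (Fin l) R) i j = A i i * N j j := by
        rw [Matrix.mul_apply, Finset.sum_eq_single j]
        · simp
        · intro k _ hk; simp [Matrix.mul_single_apply_of_ne, hk]
        · simp
      rw [e3] at e2
      rw [e1, mul_add, ← mul_assoc, mul_comm φ b, mul_assoc, e2]; ring
    rw [Finset.mul_sum]
    simp only [Finset.mul_sum, e, Finset.sum_sub_distrib, Finset.sum_add_distrib]
    congr 1
    · congr 1
      · simp [Matrix.trace, Finset.mul_sum]
      · rw [Matrix.trace, Finset.mul_sum, Finset.sum_comm]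
        simp [Matrix.mul_apply, Finset.mul_sum]
    · simp only [Matrix.trace, Matrix.diag, Finset.sum_mul, Finset.mul_sum, mul_assoc]
      rw [Finset.sum_comm]
  have hR : φ * θ (θ φ) = φ * θ φ + θ φ * θ φ - (N * N).trace + 2 * φ * N.trace - l * φ ^ 2 := by
    have e1 : θ φ = - (b * A.trace) := by rw [hθ1, htA]; ring
    have e2 : θ (θ φ) = - (b * A.trace) - b * θ A.trace := by
      conv_lhs => rw [e1]
      simp [hbθ]; ring
    have e3 : φ * θ A.trace = θ φ * A.trace + b * (A * A).trace := by
      have := congrArg Matrix.trace hAθ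
      simp only [Matrix.trace_smul, Matrix.trace_add, smul_eq_mul] at this
      rw [← this]; simp [Matrix.trace]
    have e4 : φ * θ (θ φ) = φ * θ φ - b * (φ * θ A.trace) := by rw [e2, e1]; ring
    rw [e4, e3, mul_add, ← mul_assoc b b, htAA]
    linear_combination (-(θ φ)) * e1
  rw [hL, mul_sub, hR, htNA, htA]
  have : N.trace = l * φ - θ φ := by rw [hθ1]; ring
  rw [this]; ring

theorem cas_cross (X : Matrix (Fin l) (Fin l) R) (b c : R) :
    (b - c) * ((X * (X - b • 1).adjugate) * (X * (X - c • 1).adjugate)).trace =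
      b * (X - c • 1).det * (X * (X - b • 1).adjugate).trace
      - c * (X - b • 1).det * (X * (X - c • 1).adjugate).trace := by
  set φ := (X - b • 1).det with hφ
  set A := (X - b • 1).adjugate with hA
  set ψ := (X - c • 1).det with hψ
  set A' := (X - c • 1).adjugate with hA'
  have hN : X * A = φ • 1 + b • A := N_eq X b
  have hN' : X * A' = ψ • 1 + c • A' := N_eq X c
  have h1 : (b - c) • (A * A') = ψ • A - φ • A' := by
    have : (b - c) • (A * A') = A * ((X - c • 1) - (X - b • 1)) * A' := by
      have : (X - c • 1) - (X - b • 1) = (b - c) • (1 : Matrix (Fin l) (Fin l) R) := by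
        rw [sub_smul]; abel
      rw [this]; simp
    rw [this, Matrix.mul_sub, Matrix.sub_mul, Matrix.mul_assoc, Matrix.mul_adjugate,
      Matrix.adjugate_mul]; simp [hψ, hφ]
  have h2 := congrArg Matrix.trace h1
  simp only [Matrix.trace_smul, Matrix.trace_sub, smul_eq_mul] at h2
  rw [hN, hN']
  simp only [Matrix.add_mul, Matrix.mul_add, Matrix.smul_mul, Matrix.mul_smul, Matrix.one_mul,
    Matrix.mul_one, Matrix.trace_add, Matrix.trace_smul, smul_eq_mul]
  linear_combination (b * c) * h2
end Cas

section S
variable {R : Type*} [CommRing R] [IsDomain R] [Algebra ℂ R]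

theorem drv_pow_zero (D : Derivation ℂ R R) (b : R) (h : D b = 0) (n : ℕ) : D (b ^ n) = 0 := by
  rw [Derivation.leibniz_pow, h]; simp

theorem drv_pow_eig (D : Derivation ℂ R R) (b : R) (h : D b = b) (n : ℕ) : D (b ^ n) = n * b ^ n := by
  rw [Derivation.leibniz_pow, h]
  cases n with
  | zero => simp
  | succ n => simp [pow_succ]

theorem drv_prod_log {ι : Type*} [DecidableEq ι] (D : Derivation ℂ R R) (s : Finset ι) (f : ι → R)
    (h : ∀ i ∈ s, f i ≠ 0) :
    algebraMap R (FractionRing R) (D (∏ i ∈ s, f i)) = algebraMap R (FractionRing R) (∏ i ∈ s, f i) *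
      ∑ i ∈ s, algebraMap R (FractionRing R) (D (f i)) / algebraMap R (FractionRing R) (f i) := by
  rw [drv_prod, map_sum, Finset.mul_sum]
  refine Finset.sum_congr rfl fun i hi => ?_
  rw [← Finset.mul_prod_erase s f hi, map_mul, map_mul]
  have : algebraMap R (FractionRing R) (f i) ≠ 0 := by
    simpa using h i hi
  field_simp

theorem vand_pairs {m : ℕ} (b : Fin m → R) : (vandermonde b).det =
    ∏ p ∈ (Finset.univ : Finset (Fin m × Fin m)).filter (fun p => p.1 < p.2), (b p.2 - b p.1) := by
  rw [det_vandermonde, Finset.prod_filter, ← Finset.univ_product_univ, Finset.prod_product]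
  refine Finset.prod_congr rfl fun i _ => ?_
  rw [← Finset.prod_filter]
  refine Finset.prod_congr ?_ fun _ _ => rfl
  ext j; simp

theorem drv_vand_zero {m : ℕ} (b : Fin m → R) (D : Derivation ℂ R R) (h : ∀ k, D (b k) = 0) :
    D (vandermonde b).det = 0 := by
  rw [drv_det]
  have : (vandermonde b).map D = 0 := by
    ext i j; simp [vandermonde_apply, drv_pow_zero D _ (h i)]
  simp [this]

theorem th_monom {m : ℕ} (b : Fin m → R) (θ : Fin m → Derivation ℂ R R)
    (h : ∀ k k', θ k (b k') = if k = k' then b k else 0) (e : Fin m → ℕ) (k : Fin m) :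
    θ k (∏ i, b i ^ e i) = e k * ∏ i, b i ^ e i := by
  rw [drv_prod, Finset.sum_eq_single k]
  · rw [drv_pow_eig _ _ (by simp [h]), ← Finset.mul_prod_erase _ _ (Finset.mem_univ k)]; ring
  · intro i _ hi
    rw [drv_pow_zero _ _ (by simp [h, hi.symm])]; simp
  · simp

theorem vand_expand {m : ℕ} (b : Fin m → R) : (vandermonde b).det =
    ∑ σ : Equiv.Perm (Fin m), (Equiv.Perm.sign σ : ℤ) • ∏ i, b i ^ (σ⁻¹ i : ℕ) := by
  rw [det_apply]
  refine Finset.sum_congr rfl fun σ _ => ?_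
  rw [Units.smul_def]
  congr 1
  rw [← Equiv.prod_comp σ (fun i => b i ^ (σ⁻¹ i : ℕ))]
  simp [vandermonde_apply]

theorem th_vand1 {m : ℕ} (b : Fin m → R) (θ : Fin m → Derivation ℂ R R)
    (h : ∀ k k', θ k (b k') = if k = k' then b k else 0) :
    ∑ k, θ k (vandermonde b).det = (∑ k : Fin m, ((k : ℕ) : R)) * (vandermonde b).det := by
  rw [vand_expand]
  simp only [map_sum, map_zsmul, th_monom b θ h]
  rw [Finset.sum_comm, Finset.mul_sum]
  refine Finset.sum_congr rfl fun σ _ => ?_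
  rw [← Finset.smul_sum, ← Finset.sum_mul, mul_smul_comm]
  congr 2
  exact Equiv.sum_comp σ⁻¹ (fun k : Fin m => ((k : ℕ) : R))

theorem th_vand2 {m : ℕ} (b : Fin m → R) (θ : Fin m → Derivation ℂ R R)
    (h : ∀ k k', θ k (b k') = if k = k' then b k else 0) :
    ∑ k, θ k (θ k (vandermonde b).det) = (∑ k : Fin m, ((k : ℕ) : R) ^ 2) * (vandermonde b).det := by
  rw [vand_expand]
  have key : ∀ (e : Fin m → ℕ) k, θ k (θ k (∏ i, b i ^ e i)) = (e k : R) ^ 2 * ∏ i, b i ^ e i := by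
    intro e k
    rw [th_monom b θ h, Derivation.leibniz, th_monom b θ h]
    simp; ring
  simp only [map_sum, map_zsmul, key]
  rw [Finset.sum_comm, Finset.mul_sum]
  refine Finset.sum_congr rfl fun σ _ => ?_
  rw [← Finset.smul_sum, ← Finset.sum_mul, mul_smul_comm]
  congr 2
  exact Equiv.sum_comp σ⁻¹ (fun k : Fin m => ((k : ℕ) : R) ^ 2)

theorem th_vand_log {m : ℕ} (b : Fin m → R) (θ : Fin m → Derivation ℂ R R)
    (h : ∀ k k', θ k (b k') = if k = k' then b k else 0) (hb : Function.Injective b) (k : Fin m) :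
    algebraMap R (FractionRing R) (θ k (vandermonde b).det) =
      algebraMap R (FractionRing R) (vandermonde b).det *
      ∑ k', algebraMap R (FractionRing R) (b k) /
        (algebraMap R (FractionRing R) (b k) - algebraMap R (FractionRing R) (b k')) := by
  rw [vand_pairs, drv_prod_log]
  · congr 1
    set ι := algebraMap R (FractionRing R)
    have e1 : ∀ p ∈ (Finset.univ : Finset (Fin m × Fin m)).filter (fun p => p.1 < p.2),
        ι (θ k (b p.2 - b p.1)) / ι (b p.2 - b p.1) =
        (if p.2 = k then ι (b k) / (ι (b k) - ι (b p.1)) else 0) +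
        (if p.1 = k then ι (b k) / (ι (b k) - ι (b p.2)) else 0) := by
      rintro ⟨i, j⟩ hp
      simp only [Finset.mem_filter, Finset.mem_univ, true_and] at hp
      simp only [map_sub, h]
      by_cases h1 : j = k
      · subst h1
        simp [hp.ne, hp.ne']
      · by_cases h2 : i = k
        · subst h2
          simp only [Ne.symm h1, h1, if_true, if_false, zero_sub, map_zero, zero_add]
          rw [← neg_sub (ι (b i)), neg_div_neg_eq]
        · simp [h1, h2, Ne.symm h1, Ne.symm h2]
    rw [Finset.sum_congr rfl e1, Finset.sum_filter, ← Finset.univ_product_univ, Finset.sum_product]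
    have e2 : ∀ i j : Fin m, (if i < j then
        ((if j = k then ι (b k) / (ι (b k) - ι (b i)) else 0) +
        (if i = k then ι (b k) / (ι (b k) - ι (b j)) else 0)) else 0) =
        (if j = k then (if i < k then ι (b k) / (ι (b k) - ι (b i)) else 0) else 0) +
        (if i = k then (if k < j then ι (b k) / (ι (b k) - ι (b j)) else 0) else 0) := by
      intro i j
      split_ifs <;> simp_all
    simp only [e2, Finset.sum_add_distrib, Finset.sum_ite_eq', Finset.mem_univ, if_true]
    rw [Finset.sum_comm (s := Finset.univ) (t := Finset.univ) (f := fun i j => if i = k then (if k < j then ι (b k) / (ι (b k) - ι (b j)) else 0) else 0)]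
    simp only [Finset.sum_ite_eq', Finset.mem_univ, if_true]
    rw [← Finset.sum_add_distrib]
    refine Finset.sum_congr rfl fun i _ => ?_
    rcases lt_trichotomy i k with h | h | h
    · simp [h, h.not_gt]
    · simp [h]
    · simp [h, h.not_gt]
  · rintro ⟨i, j⟩ hp
    simp only [Finset.mem_filter, Finset.mem_univ, true_and] at hp
    exact sub_ne_zero.2 fun e => hp.ne' (hb e)

variable {l m : ℕ} (X : Matrix (Fin l) (Fin l) R) (b : Fin m → R)
  (D : Fin l → Fin l → Derivation ℂ R R) (θ : Fin m → Derivation ℂ R R)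

theorem th_det_zero (b : R) (θ : Derivation ℂ R R) (hX : X.map θ = 0) (hb : θ b = 0) :
    θ (X - b • 1).det = 0 := by
  have hY : (X - b • (1 : Matrix (Fin l) (Fin l) R)).map θ = 0 := by
    rw [← hX]; ext p q
    by_cases h : p = q <;> simp [h, hb]
  rw [drv_det, hY]; simp

theorem th_Phi (hXθ : ∀ k, X.map (θ k) = 0)
    (hθ : ∀ k k', θ k (b k') = if k = k' then b k else 0) (k : Fin m) :
    θ k (∏ k, (X - b k • 1).det) =
      (∏ k' ∈ Finset.univ.erase k, (X - b k' • 1).det) * θ k (X - b k • 1).det := by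
  rw [drv_prod, Finset.sum_eq_single k]
  · intro i _ hi
    rw [th_det_zero X _ _ (hXθ k) (by simp [hθ, hi.symm])]; simp
  · simp

theorem th_Phi2 (hXθ : ∀ k, X.map (θ k) = 0)
    (hθ : ∀ k k', θ k (b k') = if k = k' then b k else 0) (k : Fin m) :
    θ k (θ k (∏ k, (X - b k • 1).det)) =
      (∏ k' ∈ Finset.univ.erase k, (X - b k' • 1).det) * θ k (θ k (X - b k • 1).det) := by
  rw [th_Phi X b θ hXθ hθ, Derivation.leibniz, drv_prod, Finset.sum_eq_zero]
  · simp
  · intro i hi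
    rw [th_det_zero X _ _ (hXθ k) (by simp [hθ, (Finset.ne_of_mem_erase hi).symm])]; simp

theorem cas_Phi
    (hX : ∀ i j, X.map (D i j) = Matrix.single i j 1 * X) (hb : ∀ i j k, D i j (b k) = 0)
    (hXθ : ∀ k, X.map (θ k) = 0) (hθ : ∀ k k', θ k (b k') = if k = k' then b k else 0)
    (h0 : ∀ k, (X - b k • 1).det ≠ 0) (hinj : Function.Injective b) :
    algebraMap R (FractionRing R) (∑ i, ∑ j, D i j (D j i (∏ k, (X - b k • 1).det))) =
    algebraMap R (FractionRing R) (∏ k, (X - b k • 1).det) * (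
      ∑ k, ((l : FractionRing R) + (l - 1) * (algebraMap R (FractionRing R) (θ k (X - b k • 1).det)
        / algebraMap R (FractionRing R) (X - b k • 1).det)
        - algebraMap R (FractionRing R) (θ k (θ k (X - b k • 1).det))
        / algebraMap R (FractionRing R) (X - b k • 1).det)
      + ∑ k, ∑ k' ∈ Finset.univ.erase k, ((l : FractionRing R) -
        (algebraMap R (FractionRing R) (b k) * (algebraMap R (FractionRing R) (θ k (X - b k • 1).det)
        / algebraMap R (FractionRing R) (X - b k • 1).det) -
        algebraMap R (FractionRing R) (b k') * (algebraMap R (FractionRing R) (θ k' (X - b k' • 1).det)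
        / algebraMap R (FractionRing R) (X - b k' • 1).det)) /
        (algebraMap R (FractionRing R) (b k) - algebraMap R (FractionRing R) (b k')))) := by
  set ι := algebraMap R (FractionRing R) with hι
  have hι0 : ∀ k, ι (X - b k • 1).det ≠ 0 := fun k => by simpa [hι] using h0 k
  set N : Fin m → Matrix (Fin l) (Fin l) R := fun k => X * (X - b k • 1).adjugate with hN
  set φ : Fin m → R := fun k => (X - b k • 1).det with hφ
  have e1 : ∀ i j k, D i j (φ k) = N k j i := fun i j k =>
    cas_first X (b k) (D i j) i j (hX i j) (hb i j k)
  have e2 : ∀ i j, D i j (D j i (∏ k, φ k)) = ∑ k, ((∏ k' ∈ Finset.univ.erase k, φ k') * D i j (N k i j)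
      + N k i j * ∑ k' ∈ Finset.univ.erase k, (∏ k'' ∈ (Finset.univ.erase k).erase k', φ k'') * N k' j i) := by
    intro i j
    rw [drv_prod, map_sum]
    refine Finset.sum_congr rfl fun k _ => ?_
    rw [Derivation.leibniz, drv_prod, smul_eq_mul, smul_eq_mul]
    simp only [e1]
  have e3 : ∑ i, ∑ j, D i j (D j i (∏ k, φ k)) = ∑ k, ((∏ k' ∈ Finset.univ.erase k, φ k') *
        (∑ i, ∑ j, D i j (N k i j))
      + ∑ k' ∈ Finset.univ.erase k, (∏ k'' ∈ (Finset.univ.erase k).erase k', φ k'') * (N k * N k').trace) := by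
    simp only [e2]
    have e3' : ∀ i : Fin l, ∑ j : Fin l, ∑ k, ((∏ k' ∈ Finset.univ.erase k, φ k') * D i j (N k i j)
      + N k i j * ∑ k' ∈ Finset.univ.erase k, (∏ k'' ∈ (Finset.univ.erase k).erase k', φ k'') * N k' j i)
      = ∑ k, ∑ j : Fin l, ((∏ k' ∈ Finset.univ.erase k, φ k') * D i j (N k i j)
      + N k i j * ∑ k' ∈ Finset.univ.erase k, (∏ k'' ∈ (Finset.univ.erase k).erase k', φ k'') * N k' j i) :=
      fun i => Finset.sum_comm
    simp only [e3']
    rw [Finset.sum_comm]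
    refine Finset.sum_congr rfl fun k _ => ?_
    simp only [Finset.sum_add_distrib, Finset.mul_sum]
    congr 1
    have : ∀ i : Fin l, ∑ j : Fin l, ∑ k' ∈ Finset.univ.erase k, N k i j * ((∏ k'' ∈ (Finset.univ.erase k).erase k', φ k'') * N k' j i)
      = ∑ k' ∈ Finset.univ.erase k, ∑ j : Fin l, N k i j * ((∏ k'' ∈ (Finset.univ.erase k).erase k', φ k'') * N k' j i) :=
      fun i => Finset.sum_comm
    simp only [this]
    rw [Finset.sum_comm]
    refine Finset.sum_congr rfl fun k' _ => ?_
    simp only [Matrix.trace, Matrix.diag, Matrix.mul_apply, Finset.mul_sum]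
    refine Finset.sum_congr rfl fun i _ => Finset.sum_congr rfl fun j _ => ?_
    ring
  rw [e3, map_sum, mul_add, Finset.mul_sum, Finset.mul_sum, ← Finset.sum_add_distrib]
  refine Finset.sum_congr rfl fun k _ => ?_
  have e4 : ∑ i, ∑ j, D i j (N k i j) = (l : R) * φ k + ((l : R) - 1) * θ k (φ k) - θ k (θ k (φ k)) :=
    cas_second X (b k) D (θ k) hX (fun i j => hb i j k) (hXθ k) (by simp [hθ]) (h0 k)
  have e5 : ∏ k, φ k = φ k * ∏ k' ∈ Finset.univ.erase k, φ k' :=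
    (Finset.mul_prod_erase _ _ (Finset.mem_univ k)).symm
  rw [map_add]
  congr 1
  · rw [e4, e5]
    have := hι0 k
    simp only [map_mul, map_sub, map_add, map_natCast, map_one]
    change ι (φ k) ≠ 0 at this
    change _ = _ * ((l : FractionRing R) + (l - 1) * (ι (θ k (φ k)) / ι (φ k)) - ι (θ k (θ k (φ k))) / ι (φ k))
    field_simp
  · rw [map_sum, Finset.mul_sum]
    refine Finset.sum_congr rfl fun k' hk' => ?_
    have hne : k ≠ k' := (Finset.ne_of_mem_erase hk').symm
    have e6 : ∏ k, φ k = φ k * (φ k' * ∏ k'' ∈ (Finset.univ.erase k).erase k', φ k'') := by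
      rw [e5, Finset.mul_prod_erase _ _ hk']
    have e7 := cas_cross X (b k) (b k')
    have e8 : ∀ k, θ k (φ k) = (l : R) * φ k - (N k).trace := fun k =>
      th_first X (b k) (θ k) (hXθ k) (by simp [hθ])
    change (b k - b k') * (N k * N k').trace = b k * φ k' * (N k).trace - b k' * φ k * (N k').trace at e7
    have e9 : (N k).trace = l * φ k - θ k (φ k) := by rw [e8]; ring
    have e10 : (N k').trace = l * φ k' - θ k' (φ k') := by rw [e8]; ring
    rw [e9, e10] at e7
    have e11 := congrArg ι e7
    simp only [map_mul, map_sub, map_natCast] at e11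
    have hd : ι (b k) - ι (b k') ≠ 0 := by
      rw [← map_sub]
      simpa [hι, sub_eq_zero] using fun e => hne (hinj e)
    have h1 : ι (φ k) ≠ 0 := hι0 k
    have h2 : ι (φ k') ≠ 0 := hι0 k'
    rw [e6]
    simp only [map_mul]
    have e12 : ι (N k * N k').trace = (ι (b k) * ι (φ k') * (l * ι (φ k) - ι (θ k (φ k)))
      - ι (b k') * ι (φ k) * (l * ι (φ k') - ι (θ k' (φ k')))) / (ι (b k) - ι (b k')) := by
      rw [eq_div_iff hd, ← e11]; ring
    rw [e12]
    change _ = _ * ((l : FractionRing R) - (ι (b k) * (ι (θ k (φ k)) / ι (φ k)) - ι (b k') * (ι (θ k' (φ k')) / ι (φ k'))) / (ι (b k) - ι (b k')))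
    field_simp
    ring

theorem cas_S
    (hX : ∀ i j, X.map (D i j) = Matrix.single i j 1 * X) (hb : ∀ i j k, D i j (b k) = 0)
    (hXθ : ∀ k, X.map (θ k) = 0) (hθ : ∀ k k', θ k (b k') = if k = k' then b k else 0)
    (h0 : ∀ k, (X - b k • 1).det ≠ 0) (hinj : Function.Injective b) :
    ∑ i, ∑ j, D i j (D j i ((vandermonde b).det * ∏ k, (X - b k • 1).det)) =
      (l * m ^ 2 + (∑ k : Fin m, ((k : ℕ) : R) ^ 2) - (l - 1) * (∑ k : Fin m, ((k : ℕ) : R))) *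
        ((vandermonde b).det * ∏ k, (X - b k • 1).det)
      + (l - 1) * ∑ k, θ k ((vandermonde b).det * ∏ k, (X - b k • 1).det)
      - ∑ k, θ k (θ k ((vandermonde b).det * ∏ k, (X - b k • 1).det)) := by
  have hDΔ : ∀ i j, D i j (vandermonde b).det = 0 := fun i j => drv_vand_zero b _ (hb i j)
  have c0 := th_vand2 b θ hθ
  have c1 := th_vand1 b θ hθ
  have hlog := th_vand_log b θ hθ hinj
  have hcas := cas_Phi X b D θ hX hb hXθ hθ h0 hinj
  have hP := th_Phi X b θ hXθ hθ
  have hP2 := th_Phi2 X b θ hXθ hθ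
  have hpe : ∀ k, ∏ k, (X - b k • 1).det = (X - b k • 1).det * ∏ k' ∈ Finset.univ.erase k, (X - b k' • 1).det :=
    fun k => (Finset.mul_prod_erase _ _ (Finset.mem_univ k)).symm
  set Δ := (vandermonde b).det with hΔ
  set Φ := ∏ k, (X - b k • 1).det with hΦ
  set φ : Fin m → R := fun k => (X - b k • 1).det with hφ
  have eD : ∀ i j, D i j (D j i (Δ * Φ)) = Δ * D i j (D j i Φ) := by
    intro i j; simp [Derivation.leibniz, hDΔ]
  have e1 : ∀ k, θ k (Δ * Φ) = Δ * θ k Φ + Φ * θ k Δ := by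
    intro k; simp [Derivation.leibniz]
  have e2 : ∀ k, θ k (θ k (Δ * Φ)) = Δ * θ k (θ k Φ) + 2 * (θ k Δ * θ k Φ) + Φ * θ k (θ k Δ) := by
    intro k; simp [Derivation.leibniz]; ring
  simp only [eD, e2]
  simp only [e1, Finset.sum_add_distrib, ← Finset.mul_sum, c0, c1]
  apply IsFractionRing.injective R (FractionRing R)
  set ι := algebraMap R (FractionRing R) with hι
  simp only [map_add, map_sub, map_mul, hcas, map_natCast, map_sum, map_pow, map_ofNat, map_one, hlog]
  have hι0 : ∀ k, ι (φ k) ≠ 0 := fun k => by simpa [hι] using h0 k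
  set τ : Fin m → FractionRing R := fun k => ι (θ k (φ k)) / ι (φ k) with hτ
  set u : Fin m → FractionRing R := fun k => ι (θ k (θ k (φ k))) / ι (φ k) with hu
  have f1 : ∀ k, ι (θ k Φ) = ι Φ * τ k := by
    intro k
    rw [hP, hpe k]; simp only [map_mul, hτ]
    have := hι0 k
    change _ = ι (φ k) * _ * _
    field_simp
    rfl
  have f2 : ∀ k, ι (θ k (θ k Φ)) = ι Φ * u k := by
    intro k
    rw [hP2, hpe k]; simp only [map_mul, hu]
    have := hι0 k
    change _ = ι (φ k) * _ * _
    field_simp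
    rfl
  simp only [f1, f2, ← Finset.mul_sum]
  have g1 : ∑ k, (ι Δ * ∑ k', ι (b k) / (ι (b k) - ι (b k'))) * (ι Φ * τ k) =
      ι Δ * ι Φ * ∑ k, ∑ k', ι (b k) * τ k / (ι (b k) - ι (b k')) := by
    rw [Finset.mul_sum]
    refine Finset.sum_congr rfl fun k _ => ?_
    rw [Finset.mul_sum, Finset.mul_sum, Finset.sum_mul]
    refine Finset.sum_congr rfl fun k' _ => ?_
    ring
  have g2 : ∑ k, ∑ k' ∈ Finset.univ.erase k, ((l : FractionRing R) -
      (ι (b k) * τ k - ι (b k') * τ k') / (ι (b k) - ι (b k'))) =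
      m * (m - 1) * l - 2 * ∑ k, ∑ k', ι (b k) * τ k / (ι (b k) - ι (b k')) := by
    have a1 : ∀ k : Fin m, ∑ k' ∈ Finset.univ.erase k, ((l : FractionRing R) -
      (ι (b k) * τ k - ι (b k') * τ k') / (ι (b k) - ι (b k'))) = (m - 1) * l -
      ∑ k', (ι (b k) * τ k - ι (b k') * τ k') / (ι (b k) - ι (b k')) := by
      intro k
      rw [Finset.sum_sub_distrib, ← Finset.sum_erase (a := k) (Finset.univ) (by simp)]
      congr 1
      rw [Finset.sum_const, Finset.card_erase_of_mem (Finset.mem_univ k), Finset.card_univ,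
        Fintype.card_fin, nsmul_eq_mul, Nat.cast_sub (by have := k.2; omega)]
      simp
    simp only [a1]
    rw [Finset.sum_sub_distrib]
    congr 1
    · simp; ring
    · simp only [sub_div, Finset.sum_sub_distrib]
      rw [two_mul, sub_eq_add_neg]
      congr 1
      rw [Finset.sum_comm, ← Finset.sum_neg_distrib]
      refine Finset.sum_congr rfl fun k _ => ?_
      rw [← Finset.sum_neg_distrib]
      refine Finset.sum_congr rfl fun k' _ => ?_
      rw [← div_neg, neg_sub]
  have g3 : ∑ k, ((l : FractionRing R) + (l - 1) * τ k - u k) = m * l + (l - 1) * ∑ k, τ k - ∑ k, u k := by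
    rw [Finset.sum_sub_distrib, Finset.sum_add_distrib, Finset.mul_sum]; simp
  change ι Δ * (ι Φ * (∑ k, ((l : FractionRing R) + (l - 1) * τ k - u k) + ∑ k, ∑ k' ∈ Finset.univ.erase k, ((l : FractionRing R) -
      (ι (b k) * τ k - ι (b k') * τ k') / (ι (b k) - ι (b k'))))) = _
  rw [g1, g2, g3]
  ring

theorem euler_S
    (hX : ∀ i j, X.map (D i j) = Matrix.single i j 1 * X) (hb : ∀ i j k, D i j (b k) = 0)
    (hXθ : ∀ k, X.map (θ k) = 0) (hθ : ∀ k k', θ k (b k') = if k = k' then b k else 0) :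
    ∑ i, D i i ((vandermonde b).det * ∏ k, (X - b k • 1).det) =
      (l * m + ∑ k : Fin m, ((k : ℕ) : R)) * ((vandermonde b).det * ∏ k, (X - b k • 1).det)
      - ∑ k, θ k ((vandermonde b).det * ∏ k, (X - b k • 1).det) := by
  have hDΔ : ∀ i j, D i j (vandermonde b).det = 0 := fun i j => drv_vand_zero b _ (hb i j)
  have c1 := th_vand1 b θ hθ
  have hP := th_Phi X b θ hXθ hθ
  simp only [Derivation.leibniz, hDΔ, hP, smul_eq_mul, mul_zero, add_zero, Finset.sum_add_distrib,
    ← Finset.mul_sum, c1, drv_prod]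
  rw [Finset.sum_comm]
  have e8 : ∀ k, θ k (X - b k • 1).det = (l : R) * (X - b k • 1).det - (X * (X - b k • 1).adjugate).trace := fun k =>
      th_first X (b k) (θ k) (hXθ k) (by simp [hθ])
  have : ∀ k, ∑ i, (∏ j ∈ Finset.univ.erase k, (X - b j • 1).det) * D i i (X - b k • 1).det =
      l * ∏ k, (X - b k • 1).det - (∏ j ∈ Finset.univ.erase k, (X - b j • 1).det) * θ k (X - b k • 1).det := by
    intro k
    rw [e8, mul_sub, ← Finset.mul_prod_erase _ _ (Finset.mem_univ k), ← Finset.mul_sum]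
    have : ∑ i, D i i (X - b k • 1).det = (X * (X - b k • 1).adjugate).trace := by
      rw [Matrix.trace]
      exact Finset.sum_congr rfl fun i _ => cas_first X (b k) (D i i) i i (hX i i) (hb i i k)
    rw [this]; ring
  simp only [this, Finset.sum_sub_distrib]
  simp
  ring
end S

instance matBorel (l : ℕ) : BorelSpace (Matrix (Fin l) (Fin l) ℂ) :=
  inferInstanceAs (BorelSpace (Fin l → Fin l → ℂ))

instance uCompact (l : ℕ) : CompactSpace (Matrix.unitaryGroup (Fin l) ℂ) := by
  have : IsCompact (Matrix.unitaryGroup (Fin l) ℂ : Set (Matrix (Fin l) (Fin l) ℂ)) := by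
    have h1 : IsCompact (Set.pi Set.univ (fun _ : Fin l => Set.pi Set.univ (fun _ : Fin l => Metric.closedBall (0 : ℂ) 1))) :=
      isCompact_univ_pi fun _ => isCompact_univ_pi fun _ => isCompact_closedBall 0 1
    refine IsCompact.of_isClosed_subset (s := (Set.pi Set.univ (fun _ : Fin l => Set.pi Set.univ (fun _ : Fin l => Metric.closedBall (0 : ℂ) 1)) : Set (Matrix (Fin l) (Fin l) ℂ))) h1 ?_ ?_
    · have : (Matrix.unitaryGroup (Fin l) ℂ : Set (Matrix (Fin l) (Fin l) ℂ)) = {A | A * star A = 1} := by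
        ext A; simp [Matrix.mem_unitaryGroup_iff]
      rw [this]
      exact isClosed_eq (by fun_prop) (by fun_prop)
    · intro A hA i _ j _
      simpa using entry_norm_bound_of_unitary hA i j
  exact isCompact_iff_compactSpace.1 this

instance uBorel (l : ℕ) : BorelSpace (Matrix.unitaryGroup (Fin l) ℂ) := Subtype.borelSpace _
instance uSC (l : ℕ) : SecondCountableTopology (Matrix.unitaryGroup (Fin l) ℂ) :=
  haveI : SecondCountableTopology (Matrix (Fin l) (Fin l) ℂ) := inferInstanceAs (SecondCountableTopology (Fin l → Fin l → ℂ))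
  TopologicalSpace.Subtype.secondCountableTopology _

theorem u_int {l : ℕ} (μ : Measure (Matrix.unitaryGroup (Fin l) ℂ)) [IsProbabilityMeasure μ]
    (f : Matrix.unitaryGroup (Fin l) ℂ → ℂ) (hf : Continuous f) : Integrable f μ :=
  hf.integrable_of_hasCompactSupport (HasCompactSupport.of_compactSpace f)

section
abbrev BB (l m : ℕ) := MvPolynomial (Fin m ⊕ Fin l × Fin l) ℂ

variable {l m : ℕ}

noncomputable def XM (l m : ℕ) : Matrix (Fin l) (Fin l) (BB l m) := fun p q => MvPolynomial.X (Sum.inr (p, q))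
noncomputable def bX (l m : ℕ) : Fin m → BB l m := fun k => MvPolynomial.X (Sum.inl k)

noncomputable def ev (U : Matrix (Fin l) (Fin l) ℂ) : BB l m →ₐ[ℂ] MvPolynomial (Fin m) ℂ :=
  MvPolynomial.aeval (Sum.elim MvPolynomial.X (fun pq => MvPolynomial.C (U pq.1 pq.2)))

noncomputable def dm (M : Matrix (Fin l) (Fin l) ℂ) : Fin m ⊕ Fin l × Fin l → BB l m :=
  Sum.elim 0 (fun pq => ∑ r, MvPolynomial.C (M pq.1 r) * MvPolynomial.X (Sum.inr (r, pq.2)))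

noncomputable def DM (M : Matrix (Fin l) (Fin l) ℂ) : Derivation ℂ (BB l m) (BB l m) :=
  MvPolynomial.mkDerivation ℂ (dm M)

noncomputable def TH (k : Fin m) : Derivation ℂ (BB l m) (BB l m) :=
  MvPolynomial.mkDerivation ℂ (Sum.elim (Pi.single k (MvPolynomial.X (Sum.inl k))) 0)

noncomputable def RP (M : Matrix (Fin l) (Fin l) ℂ) : BB l m →ₐ[ℂ] Polynomial (BB l m) :=
  MvPolynomial.aeval (fun x => Polynomial.C (MvPolynomial.X x) + (Polynomial.X - 1) * Polynomial.C (dm M x))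

theorem RP_one (M : Matrix (Fin l) (Fin l) ℂ) (b : BB l m) : (RP M b).eval 1 = b := by
  induction b using MvPolynomial.induction_on with
  | C c => simp [RP, MvPolynomial.aeval_C, Polynomial.algebraMap_apply]
  | add p q hp hq => simp [hp, hq]
  | mul_X p x hp => simp [hp]; simp [RP]

theorem RP_deriv (M : Matrix (Fin l) (Fin l) ℂ) (b : BB l m) :
    (Polynomial.derivative (RP M b)).eval 1 = DM M b := by
  induction b using MvPolynomial.induction_on with
  | C c => simp [RP, MvPolynomial.aeval_C, Polynomial.algebraMap_apply]
  | add p q hp hq => simp [hp, hq]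
  | mul_X p x hp =>
    have h1 : (RP M (MvPolynomial.X x : BB l m)).eval 1 = MvPolynomial.X x := RP_one _ _
    have h2 : (Polynomial.derivative (RP M (MvPolynomial.X x : BB l m))).eval 1 = dm M x := by simp [RP]
    rw [map_mul, Polynomial.derivative_mul, Polynomial.eval_add, Polynomial.eval_mul, Polynomial.eval_mul,
      hp, h1, h2, RP_one, Derivation.leibniz]
    simp [DM, MvPolynomial.mkDerivation_X]; ring

theorem RP_ev (M U : Matrix (Fin l) (Fin l) ℂ) (w : ℂ) (b : BB l m) :
    ev U ((RP M b).eval (MvPolynomial.C w)) = ev ((1 + (w - 1) • M) * U) b := by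
  induction b using MvPolynomial.induction_on with
  | C c => simp [RP, MvPolynomial.aeval_C, Polynomial.algebraMap_apply, ev]
  | add p q hp hq => simp [hp, hq]
  | mul_X p x hp =>
    rw [map_mul, Polynomial.eval_mul, map_mul, map_mul, hp]
    refine congrArg (_ * ·) ?_
    rcases x with k | ⟨p, q⟩
    · simp [RP, ev, dm]
    · have h1 : (RP M (MvPolynomial.X (Sum.inr (p, q)) : BB l m)).eval (MvPolynomial.C w) =
          MvPolynomial.X (Sum.inr (p, q)) + (MvPolynomial.C w - 1) * ∑ r, MvPolynomial.C (M p r) * MvPolynomial.X (Sum.inr (r, q)) := by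
        rw [RP, MvPolynomial.aeval_X, Polynomial.eval_add, Polynomial.eval_mul, Polynomial.eval_C,
          Polynomial.eval_C, Polynomial.eval_sub, Polynomial.eval_X, Polynomial.eval_one]
        rfl
      have h2 : ∀ (V : Matrix (Fin l) (Fin l) ℂ) r, ev V (MvPolynomial.X (Sum.inr (r, q)) : BB l m) = MvPolynomial.C (V r q) := by
        intro V r; rw [ev, MvPolynomial.aeval_X]; rfl
      have h3 : ∀ c, ev U (MvPolynomial.C c : BB l m) = MvPolynomial.C c := by
        intro c; rw [ev, MvPolynomial.aeval_C]; rfl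
      rw [h1, map_add, map_mul, map_sub, map_one, map_sum, h2, h2, h3]
      simp only [map_mul, h2, h3]
      rw [Matrix.add_mul, Matrix.one_mul, Matrix.smul_mul, Matrix.add_apply, Matrix.smul_apply, Matrix.mul_apply]
      simp only [smul_eq_mul, map_add, map_mul, map_sum, map_sub, map_one]

theorem ev_cont (b : BB l m) (ν : Fin m →₀ ℕ) : Continuous fun U : Matrix (Fin l) (Fin l) ℂ => (ev U b).coeff ν := by
  induction b using MvPolynomial.induction_on generalizing ν with
  | C c => simp [ev]; exact continuous_const
  | add p q hp hq => simp only [map_add, MvPolynomial.coeff_add]; exact (hp ν).add (hq ν)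
  | mul_X p x hp =>
    simp only [map_mul]
    rcases x with k | ⟨i, j⟩
    · simp only [ev, MvPolynomial.aeval_X, Sum.elim_inl, MvPolynomial.coeff_mul_X']
      split_ifs
      · exact hp _
      · exact continuous_const
    · simp only [ev, MvPolynomial.aeval_X, Sum.elim_inr]
      simp only [mul_comm _ (MvPolynomial.C _), MvPolynomial.coeff_C_mul]
      exact Continuous.mul (by fun_prop) (hp ν)

variable (μ : Measure (Matrix.unitaryGroup (Fin l) ℂ)) [μ.IsHaarMeasure] [IsProbabilityMeasure μ]

theorem lam_cont (a : ℕ) (ν : Fin m →₀ ℕ) (b : BB l m) :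
    Continuous fun U : Matrix.unitaryGroup (Fin l) ℂ => (star (U : Matrix (Fin l) (Fin l) ℂ).det) ^ a * (ev (U : Matrix (Fin l) (Fin l) ℂ) b).coeff ν := by
  have := (ev_cont b ν).comp (continuous_subtype_val (p := (· ∈ Matrix.unitaryGroup (Fin l) ℂ)))
  refine Continuous.mul ?_ this
  have h : Continuous fun U : Matrix.unitaryGroup (Fin l) ℂ => (U : Matrix (Fin l) (Fin l) ℂ).det :=
    Continuous.matrix_det continuous_subtype_val
  fun_prop

noncomputable def lam (a : ℕ) (ν : Fin m →₀ ℕ) : BB l m →ₗ[ℂ] ℂ where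
  toFun b := ∫ U, (star (U : Matrix (Fin l) (Fin l) ℂ).det) ^ a * (ev (U : Matrix (Fin l) (Fin l) ℂ) b).coeff ν ∂μ
  map_add' x y := by
    rw [← integral_add (u_int μ _ (lam_cont a ν x)) (u_int μ _ (lam_cont a ν y))]
    congr 1; ext U
    simp [mul_add]
  map_smul' c x := by
    simp only [RingHom.id_apply, smul_eq_mul]
    rw [← integral_const_mul]
    congr 1; ext U
    simp; ring

theorem lam_RP (M : Matrix (Fin l) (Fin l) ℂ) (w : ℂ) (a : ℕ) (ν : Fin m →₀ ℕ) (b : BB l m)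
    (hM : 1 + (w - 1) • M ∈ Matrix.unitaryGroup (Fin l) ℂ) :
    lam μ a ν ((RP M b).eval (MvPolynomial.C w)) = (1 + (w - 1) • M).det ^ a * lam μ a ν b := by
  simp only [lam, LinearMap.coe_mk, AddHom.coe_mk, RP_ev]
  set V : Matrix.unitaryGroup (Fin l) ℂ := ⟨_, hM⟩ with hV
  have hVd : (1 + (w - 1) • M).det * star (1 + (w - 1) • M).det = 1 := by
    have := Matrix.det_of_mem_unitary hM
    exact (Unitary.mem_iff.1 this).2
  rw [← integral_mul_left_eq_self (fun U : Matrix.unitaryGroup (Fin l) ℂ =>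
    (star (U : Matrix (Fin l) (Fin l) ℂ).det) ^ a * (ev (U : Matrix (Fin l) (Fin l) ℂ) b).coeff ν) V, ← integral_const_mul]
  congr 1; ext U
  have : ((V * U : Matrix.unitaryGroup (Fin l) ℂ) : Matrix (Fin l) (Fin l) ℂ) = (1 + (w - 1) • M) * U := by
    simp [hV]
  rw [this, Matrix.det_mul, star_mul, ← mul_assoc, ← mul_pow]
  congr 2
  linear_combination (-star (U : Matrix (Fin l) (Fin l) ℂ).det) * hVd

theorem lam_DM (v : Fin l → ℂ) (hv : star v ⬝ᵥ v = 1) (a : ℕ) (ν : Fin m →₀ ℕ) (b : BB l m) :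
    lam μ a ν (DM (vecMulVec v (star v)) b) = a * lam μ a ν b := by
  set M := vecMulVec v (star v) with hM
  set R := RP M b with hR
  have hMM : M * M = M := by
    rw [hM, Matrix.vecMulVec_mul_vecMulVec, hv]; simp
  have hMs : star M = M := by
    ext i j; simp [hM, vecMulVec_apply, mul_comm]
  have hdet : ∀ w : ℂ, (1 + (w - 1) • M).det = w := by
    intro w
    have : (w - 1) • M = replicateCol Unit ((w - 1) • v) * replicateRow Unit (star v) := by
      ext i j; simp [hM, vecMulVec_apply, Matrix.mul_apply, mul_assoc]
    rw [this, Matrix.det_one_add_replicateCol_mul_replicateRow, dotProduct_smul, hv]; simp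
  have hun : ∀ w : ℂ, ‖w‖ = 1 → 1 + (w - 1) • M ∈ Matrix.unitaryGroup (Fin l) ℂ := by
    intro w hw
    rw [Matrix.mem_unitaryGroup_iff]
    have hw' : w * star w = 1 := by
      have := Complex.mul_conj w
      rw [Complex.star_def, this, Complex.normSq_eq_norm_sq, hw]; simp
    rw [star_add, star_one, star_smul, hMs]
    simp only [add_mul, mul_add, one_mul, mul_one, smul_mul_smul_comm, hMM]
    have : ((w - 1) + star (w - 1) + (w - 1) * star (w - 1)) • M = 0 := by
      have : (w - 1) + star (w - 1) + (w - 1) * star (w - 1) = 0 := by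
        rw [star_sub, star_one]; linear_combination hw'
      rw [this, zero_smul]
    rw [add_smul, add_smul] at this
    calc _ = 1 + ((w - 1) • M + star (w - 1) • M + ((w - 1) * star (w - 1)) • M) := by abel
      _ = 1 := by rw [this, add_zero]
  set Q : Polynomial ℂ := ∑ k ∈ Finset.range (R.natDegree + 1), Polynomial.monomial k (lam μ a ν (R.coeff k)) with hQ
  have hQe : ∀ w : ℂ, Q.eval w = lam μ a ν (R.eval (MvPolynomial.C w)) := by
    intro w
    rw [Polynomial.eval_eq_sum_range (p := R), map_sum, hQ, Polynomial.eval_finsetSum]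
    refine Finset.sum_congr rfl fun k _ => ?_
    rw [Polynomial.eval_monomial, ← map_pow, mul_comm (R.coeff k), ← MvPolynomial.smul_eq_C_mul, map_smul, smul_eq_mul, mul_comm]
  have hQ2 : Q = Polynomial.C (lam μ a ν b) * Polynomial.X ^ a := by
    apply Polynomial.eq_of_infinite_eval_eq
    have hinf : (Metric.sphere (0 : ℂ) 1).Infinite := by
      refine (isPreconnected_sphere (by rw [Complex.rank_real_complex]; norm_num) 0 1).infinite_of_nontrivial ?_
      exact ⟨1, by simp, -1, by simp, by norm_num⟩
    refine hinf.mono ?_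
    intro w hw
    have hw : ‖w‖ = 1 := by simpa using hw
    simp only [Set.mem_ofPred_eq]
    rw [hQe, hR, lam_RP μ M w a ν b (hun w hw), hdet]
    rw [Polynomial.eval_mul, Polynomial.eval_C, Polynomial.eval_pow, Polynomial.eval_X, mul_comm]
  have hd : (Polynomial.derivative Q).eval 1 = lam μ a ν (DM M b) := by
    rw [← RP_deriv, ← hR, Polynomial.derivative_eval R, Polynomial.sum_over_range _ (by simp), map_sum, map_sum, Polynomial.eval_finsetSum]
    refine Finset.sum_congr rfl fun k _ => ?_
    rw [Polynomial.derivative_monomial, Polynomial.eval_monomial]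
    simp only [one_pow, mul_one]
    rw [← map_natCast (MvPolynomial.C (R := ℂ)) k, mul_comm (R.coeff k), ← MvPolynomial.smul_eq_C_mul, map_smul, smul_eq_mul, mul_comm]
  rw [← hd, hQ2, Polynomial.derivative_C_mul_X_pow, Polynomial.eval_mul, Polynomial.eval_C, Polynomial.eval_pow, Polynomial.eval_X, one_pow, mul_one, mul_comm]
end

section
variable {l m : ℕ}

theorem DM_add (M N : Matrix (Fin l) (Fin l) ℂ) (b : BB l m) : DM (M + N) b = DM M b + DM N b := by
  have : DM (m := m) (M + N) = DM M + DM N := by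
    apply MvPolynomial.derivation_ext
    intro x
    rw [Derivation.add_apply, DM, DM, DM, MvPolynomial.mkDerivation_X, MvPolynomial.mkDerivation_X, MvPolynomial.mkDerivation_X]
    rcases x with k | ⟨p, q⟩
    · simp [dm]
    · simp [dm, add_mul, Finset.sum_add_distrib]
  rw [this]; rfl

theorem DM_smul (c : ℂ) (M : Matrix (Fin l) (Fin l) ℂ) (b : BB l m) : DM (c • M) b = c • DM M b := by
  have : DM (m := m) (c • M) = c • DM M := by
    apply MvPolynomial.derivation_ext
    intro x
    rw [Derivation.smul_apply, DM, DM, MvPolynomial.mkDerivation_X, MvPolynomial.mkDerivation_X]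
    rcases x with k | ⟨p, q⟩
    · simp [dm]
    · simp [dm, mul_assoc, MvPolynomial.smul_eq_C_mul, Finset.mul_sum]
  rw [this]; rfl

theorem TH_ev (U : Matrix (Fin l) (Fin l) ℂ) (k : Fin m) (b : BB l m) (ν : Fin m →₀ ℕ) :
    (ev U (TH k b)).coeff ν = ν k * (ev U b).coeff ν := by
  have h1 : ∀ b : BB l m, ev U (TH k b) = MvPolynomial.X k * MvPolynomial.pderiv k (ev U b) := by
    intro b
    induction b using MvPolynomial.induction_on with
    | C c => simp [ev, TH]
    | add p q hp hq => rw [map_add, map_add, hp, hq, map_add, map_add, mul_add]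
    | mul_X p x hp =>
      rw [Derivation.leibniz, map_add, smul_eq_mul, smul_eq_mul, map_mul, map_mul, hp, map_mul,
        Derivation.leibniz, smul_eq_mul, smul_eq_mul]
      have : ev U (TH k (MvPolynomial.X x : BB l m)) = MvPolynomial.X k * MvPolynomial.pderiv k (ev U (MvPolynomial.X x : BB l m)) := by
        rw [TH, MvPolynomial.mkDerivation_X]
        rcases x with j | ⟨p, q⟩
        · by_cases h : j = k
          · subst h; simp [ev]
          · simp [ev, h, MvPolynomial.pderiv_X_of_ne (R := ℂ) h]
        · simp [ev]
      rw [this]; ring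
  rw [h1]
  generalize ev U b = p
  induction p using MvPolynomial.induction_on' with
  | monomial s c =>
    rw [MvPolynomial.X_mul_pderiv_monomial]
    simp only [MvPolynomial.coeff_smul, MvPolynomial.coeff_monomial]
    split_ifs with h
    · subst h; simp
    · simp
  | add p q hp hq => rw [map_add, mul_add, MvPolynomial.coeff_add, hp, hq, MvPolynomial.coeff_add]; ring

variable (μ : Measure (Matrix.unitaryGroup (Fin l) ℂ)) [μ.IsHaarMeasure] [IsProbabilityMeasure μ]

theorem lam_TH (a : ℕ) (k : Fin m) (b : BB l m) (ν : Fin m →₀ ℕ) :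
    lam μ a ν (TH k b) = ν k * lam μ a ν b := by
  simp only [lam, LinearMap.coe_mk, AddHom.coe_mk, TH_ev]
  rw [← integral_const_mul]
  congr 1; ext U; ring

theorem lam_vv (a : ℕ) (b : BB l m) (ν : Fin m →₀ ℕ) (v : Fin l → ℂ) (r : ℝ) (hr : 0 < r)
    (hv : star v ⬝ᵥ v = (r : ℂ)) : lam μ a ν (DM (vecMulVec v (star v)) b) = r * (a * lam μ a ν b) := by
  have hs : ((Real.sqrt r : ℝ) : ℂ) * (Real.sqrt r : ℝ) = r := by
    rw [← Complex.ofReal_mul, Real.mul_self_sqrt hr.le]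
  have hs0 : ((Real.sqrt r : ℝ) : ℂ) ≠ 0 := by
    simpa using (Real.sqrt_pos.2 hr).ne'
  have hr0 : (r : ℂ) ≠ 0 := by exact_mod_cast hr.ne'
  have := lam_DM μ (((Real.sqrt r : ℝ) : ℂ)⁻¹ • v) (by
    rw [star_smul, smul_dotProduct, dotProduct_smul, hv]
    simp only [star_inv₀, Complex.star_def, Complex.conj_ofReal, smul_eq_mul]
    rw [← mul_assoc, ← mul_inv, hs]; field_simp) a ν b
  rw [← this]
  have e : vecMulVec v (star v) = (r : ℂ) • vecMulVec (((Real.sqrt r : ℝ) : ℂ)⁻¹ • v) (star (((Real.sqrt r : ℝ) : ℂ)⁻¹ • v)) := by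
    ext i j
    simp only [vecMulVec_apply, Matrix.smul_apply, Pi.smul_apply, Pi.star_apply, star_mul, star_smul,
      star_inv₀, Complex.star_def, Complex.conj_ofReal, smul_eq_mul]
    rw [← hs]; field_simp
  rw [e, DM_smul, map_smul, smul_eq_mul]

theorem vv_single (i : Fin l) : vecMulVec (Pi.single i (1 : ℂ)) (star (Pi.single i (1 : ℂ))) = Matrix.single i i 1 := by
  ext p q
  simp only [vecMulVec_apply, Matrix.single_apply, Pi.single_apply, Pi.star_apply]
  by_cases h1 : p = i
  · subst h1
    by_cases h2 : q = p
    · subst h2; simp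
    · simp [h2, Ne.symm h2]
  · simp [h1, Ne.symm h1]

theorem vv_pair (i j : Fin l) (hij : ¬ i = j) (c : ℂ) (hcc : c * star c = 1) :
    vecMulVec (Pi.single i 1 + Pi.single j c) (star (Pi.single i 1 + Pi.single j c)) =
  ((Matrix.single i i 1 + Matrix.single j j 1) + (star c • Matrix.single i j 1 + c • Matrix.single j i 1) : Matrix (Fin l) (Fin l) ℂ) := by
  ext p q
  simp only [vecMulVec_apply, Matrix.single_apply, Pi.add_apply, Pi.single_apply, Pi.star_apply, Matrix.add_apply, Matrix.smul_apply, smul_eq_mul]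
  by_cases h1 : p = i
  · subst h1
    by_cases h2 : q = p
    · subst h2; simp [hij, Ne.symm hij]
    · by_cases h3 : q = j
      · subst h3; simp [hij, Ne.symm hij]
      · simp [hij, Ne.symm hij, h2, h3, Ne.symm h2, Ne.symm h3]
  · by_cases h1' : p = j
    · subst h1'
      by_cases h2 : q = p
      · subst h2; simp [hij, Ne.symm hij]; simpa using hcc
      · by_cases h3 : q = i
        · subst h3; simp [hij, Ne.symm hij]
        · simp [hij, Ne.symm hij, h2, h3, Ne.symm h2, Ne.symm h3]
    · simp [h1, h1', Ne.symm h1, Ne.symm h1']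

theorem lam_D (a : ℕ) (b : BB l m) (ν : Fin m →₀ ℕ) (i j : Fin l) :
    lam μ a ν (DM (Matrix.single i j 1) b) = if i = j then a * lam μ a ν b else 0 := by
  have hii : ∀ i, lam μ a ν (DM (Matrix.single i i 1) b) = a * lam μ a ν b := by
    intro i
    have := lam_vv μ a b ν (Pi.single i 1) 1 one_pos (by simp)
    rw [Complex.ofReal_one, one_mul] at this
    rw [vv_single] at this
    exact this
  split_ifs with hij
  · subst hij; exact hii i
  · have hc : ∀ c : ℂ, c * star c = 1 → star c * lam μ a ν (DM (Matrix.single i j 1) b) + c * lam μ a ν (DM (Matrix.single j i 1) b) = 0 := by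
      intro c hcc
      have h := lam_vv μ a b ν (Pi.single i 1 + Pi.single j c) 2 two_pos (by
        simp [dotProduct_add, add_dotProduct, hij, Ne.symm hij]
        rw [Complex.star_def] at hcc
        linear_combination hcc)
      have e := vv_pair i j hij c hcc
      rw [e, DM_add, DM_add, DM_add, DM_smul, DM_smul, map_add, map_add, map_add, map_smul, map_smul, hii, hii] at h
      simp only [smul_eq_mul] at h
      push_cast at h
      linear_combination h
    have h1 := hc 1 (by simp)
    have h2 := hc Complex.I (by simp)
    simp only [star_one, Complex.star_def, Complex.conj_I] at h1 h2
    have h3 : Complex.I * (2 * lam μ a ν (DM (Matrix.single i j 1) b)) = 0 := by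
      linear_combination Complex.I * h1 - h2
    simpa using h3

noncomputable def SS (l m : ℕ) : BB l m := (vandermonde (bX l m)).det * ∏ k, (XM l m - bX l m k • 1).det

theorem lam_C (a : ℕ) (ν : Fin m →₀ ℕ) (c : ℂ) (b : BB l m) : lam μ a ν (MvPolynomial.C c * b) = c * lam μ a ν b := by
  rw [← MvPolynomial.smul_eq_C_mul, map_smul, smul_eq_mul]

theorem hypX (i j : Fin l) : (XM l m).map (DM (Matrix.single i j 1)) = Matrix.single i j 1 * XM l m := by
  ext1 p q
  rw [Matrix.map_apply, XM, DM, MvPolynomial.mkDerivation_X]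
  simp only [dm, Sum.elim_inr, Matrix.mul_apply, XM]
  refine Finset.sum_congr rfl fun r _ => ?_
  congr 1
  simp only [Matrix.single_apply]
  split_ifs <;> simp

theorem hypb (i j : Fin l) (k : Fin m) : DM (Matrix.single i j 1) (bX l m k) = 0 := by
  rw [bX, DM, MvPolynomial.mkDerivation_X]; rfl

theorem hypXth (k : Fin m) : (XM l m).map (TH k) = 0 := by
  ext1 p q
  rw [Matrix.map_apply, XM, TH, MvPolynomial.mkDerivation_X]; rfl

theorem hypth (k k' : Fin m) : TH k (bX l m k') = if k = k' then bX l m k else 0 := by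
  rw [bX, TH, MvPolynomial.mkDerivation_X]
  by_cases h : k = k'
  · subst h; simp [bX]
  · simp [h, Ne.symm h]

theorem hypinj : Function.Injective (bX l m) := fun i j h => by
  simpa [bX] using h

theorem ev_XM (U : Matrix (Fin l) (Fin l) ℂ) (k : Fin m) :
    ev U (XM l m - bX l m k • 1).det = (U.map MvPolynomial.C - (MvPolynomial.X k : MvPolynomial (Fin m) ℂ) • 1).det := by
  rw [AlgHom.map_det]
  congr 1
  ext1 p q
  simp only [AlgHom.mapMatrix_apply, Matrix.map_apply, Matrix.sub_apply, Matrix.smul_apply, map_sub, smul_eq_mul, map_mul]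
  rw [XM, bX, ev, MvPolynomial.aeval_X, MvPolynomial.aeval_X]
  refine congrArg₂ _ rfl (congrArg₂ _ rfl ?_)
  by_cases h : p = q
  · subst h; rw [Matrix.one_apply_eq, Matrix.one_apply_eq, map_one]
  · rw [Matrix.one_apply_ne h, Matrix.one_apply_ne h, map_zero]

theorem hyp0 (k : Fin m) : (XM l m - bX l m k • 1).det ≠ 0 := by
  intro h
  have := ev_XM (m := m) (0 : Matrix (Fin l) (Fin l) ℂ) k
  rw [h, map_zero] at this
  have e : ((0 : Matrix (Fin l) (Fin l) ℂ).map MvPolynomial.C - (MvPolynomial.X k : MvPolynomial (Fin m) ℂ) • (1 : Matrix (Fin l) (Fin l) (MvPolynomial (Fin m) ℂ))) =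
    (-MvPolynomial.X k : MvPolynomial (Fin m) ℂ) • (1 : Matrix (Fin l) (Fin l) _) := by
    ext1 p q; simp
  rw [e, Matrix.det_smul, Matrix.det_one, mul_one] at this
  exact pow_ne_zero _ (neg_ne_zero.2 (MvPolynomial.X_ne_zero k)) this.symm

theorem supp1 (a : ℕ) (ν : Fin m →₀ ℕ) (h : lam μ a ν (SS l m) ≠ 0) :
    (∑ k, (ν k : ℤ)) = l * m - a * l + ∑ k : Fin m, ((k : ℕ) : ℤ) := by
  have e := congrArg (lam μ a ν) (euler_S (XM l m) (bX l m) (fun i j => DM (Matrix.single i j 1)) TH hypX hypb hypXth hypth)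
  have hc : ((l : BB l m) * (m : BB l m) + ∑ k : Fin m, ((k : ℕ) : BB l m)) = MvPolynomial.C ((l : ℂ) * m + ∑ k : Fin m, ((k : ℕ) : ℂ)) := by
    simp
  rw [hc, map_sub, map_sum, map_sum] at e
  change _ = lam μ a ν (MvPolynomial.C _ * SS l m) - ∑ k, lam μ a ν (TH k (SS l m)) at e
  simp only [lam_D, lam_TH, lam_C, if_true] at e
  change ∑ i : Fin l, (a : ℂ) * lam μ a ν (SS l m) = _ at e
  rw [← Finset.sum_mul (f := fun k => (ν k : ℂ))] at e
  rw [Finset.sum_const, nsmul_eq_mul, Finset.card_univ, Fintype.card_fin] at e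
  have e2 : (∑ k, (ν k : ℂ)) = l * m - a * l + ∑ k : Fin m, ((k : ℕ) : ℂ) := by
    apply mul_right_cancel₀ h
    linear_combination e
  exact_mod_cast e2

theorem supp2 (a : ℕ) (ν : Fin m →₀ ℕ) (h : lam μ a ν (SS l m) ≠ 0) :
    (∑ k, (ν k : ℤ) ^ 2) = l * m ^ 2 + ∑ k : Fin m, ((k : ℕ) : ℤ) ^ 2 - (l - 1) * ∑ k : Fin m, ((k : ℕ) : ℤ)
      + (l - 1) * (∑ k, (ν k : ℤ)) - l * a ^ 2 := by
  have e := congrArg (lam μ a ν) (cas_S (XM l m) (bX l m) (fun i j => DM (Matrix.single i j 1)) TH hypX hypb hypXth hypth hyp0 hypinj)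
  have hc : ((l : BB l m) * (m : BB l m) ^ 2 + (∑ k : Fin m, ((k : ℕ) : BB l m) ^ 2) - ((l : BB l m) - 1) * ∑ k : Fin m, ((k : ℕ) : BB l m)) =
     MvPolynomial.C ((l : ℂ) * m ^ 2 + (∑ k : Fin m, ((k : ℕ) : ℂ) ^ 2) - (l - 1) * ∑ k : Fin m, ((k : ℕ) : ℂ)) := by
    simp
  have hc2 : ((l : BB l m) - 1) = MvPolynomial.C ((l : ℂ) - 1) := by simp
  rw [hc, hc2, map_sub, map_add, map_sum, map_sum] at e
  change _ = lam μ a ν (MvPolynomial.C _ * SS l m) + lam μ a ν (MvPolynomial.C _ * ∑ k, TH k (SS l m)) - ∑ k, lam μ a ν (TH k (TH k (SS l m))) at e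
  simp only [lam_D, lam_TH, lam_C, if_true, map_sum] at e
  rw [← Finset.sum_mul] at e
  change ∑ i : Fin l, ∑ j : Fin l, (if i = j then (a : ℂ) * (if j = i then (a : ℂ) * lam μ a ν (SS l m) else 0) else 0) = _ at e
  simp only [Finset.sum_ite_eq, Finset.mem_univ, if_true] at e
  rw [Finset.sum_const, nsmul_eq_mul, Finset.card_univ, Fintype.card_fin] at e
  have e3 : ∑ k, (ν k : ℂ) * (ν k * lam μ a ν (SS l m)) = (∑ k, (ν k : ℂ) ^ 2) * lam μ a ν (SS l m) := by
    rw [Finset.sum_mul]; exact Finset.sum_congr rfl fun k _ => by ring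
  rw [e3] at e
  have e2 : (∑ k, (ν k : ℂ) ^ 2) = l * m ^ 2 + ∑ k : Fin m, ((k : ℕ) : ℂ) ^ 2 - (l - 1) * ∑ k : Fin m, ((k : ℕ) : ℂ)
      + (l - 1) * (∑ k, (ν k : ℂ)) - l * a ^ 2 := by
    apply mul_right_cancel₀ h
    linear_combination e
  exact_mod_cast e2
end

/-- the distinguished exponents -/
def nu0 (l a : ℕ) (j : ℕ) : ℕ := if j < a then j else j + l

theorem nu0_inj (l a : ℕ) : Function.Injective (nu0 l a) := by
  intro i j h; unfold nu0 at h; split_ifs at h <;> omega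

theorem nu0_sum (l a m : ℕ) (h : a ≤ m) : ∑ j ∈ Finset.range m, (nu0 l a j : ℤ) =
    l * m - a * l + ∑ j ∈ Finset.range m, (j : ℤ) := by
  induction m, h using Nat.le_induction with
  | base =>
    rw [Finset.sum_congr rfl (g := fun j : ℕ => (j : ℤ))]
    · ring
    · intro j hj; simp [nu0, Finset.mem_range.1 hj]
  | succ m hm ih =>
    rw [Finset.sum_range_succ, Finset.sum_range_succ, ih]
    simp [nu0, Nat.not_lt.2 hm]; ring

theorem nu0_sum2 (l a m : ℕ) (h : a ≤ m) : ∑ j ∈ Finset.range m, (nu0 l a j : ℤ) ^ 2 =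
    l * m ^ 2 + ∑ j ∈ Finset.range m, (j : ℤ) ^ 2 + (l - 1) * (l * m - a * l) - l * a ^ 2 := by
  induction m, h using Nat.le_induction with
  | base =>
    rw [Finset.sum_congr rfl (g := fun j : ℕ => (j : ℤ) ^ 2)]
    · ring
    · intro j hj; simp [nu0, Finset.mem_range.1 hj]
  | succ m hm ih =>
    rw [Finset.sum_range_succ, Finset.sum_range_succ, ih]
    simp [nu0, Nat.not_lt.2 hm]; ring

theorem comb_perm (l a m : ℕ) (hl : 1 ≤ l) (h : a ≤ m) (ν : Fin m → ℕ) (hinj : Function.Injective ν)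
    (hlt : ∀ k, ν k < l + m)
    (h1 : (∑ k, (ν k : ℤ)) = l * m - a * l + ∑ k : Fin m, ((k : ℕ) : ℤ))
    (h2 : (∑ k, (ν k : ℤ) ^ 2) = l * m ^ 2 + ∑ k : Fin m, ((k : ℕ) : ℤ) ^ 2 - (l - 1) * ∑ k : Fin m, ((k : ℕ) : ℤ)
      + (l - 1) * (∑ k, (ν k : ℤ)) - l * a ^ 2) :
    ∃ σ : Equiv.Perm (Fin m), ∀ k, ν k = nu0 l a (σ k) := by
  classical
  set A := Finset.image ν Finset.univ with hA
  set A0 := Finset.image (nu0 l a) (Finset.range m) with hA0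
  have cA : A.card = m := by rw [hA, Finset.card_image_of_injective _ hinj]; simp
  have cA0 : A0.card = m := by rw [hA0, Finset.card_image_of_injective _ (nu0_inj l a)]; simp
  set g : ℕ → ℤ := fun x => (x - a) * (x - (l + a - 1)) with hg
  have e1 : ∑ x ∈ A, g x = ∑ x ∈ A0, g x := by
    rw [hA, hA0, Finset.sum_image (fun _ _ _ _ e => hinj e), Finset.sum_image (fun _ _ _ _ e => nu0_inj l a e)]
    have f1 : ∑ k, g (ν k) = (∑ k, (ν k : ℤ) ^ 2) - (2 * a + l - 1) * (∑ k, (ν k : ℤ)) + m * (a * (l + a - 1)) := by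
      have : ∀ k, g (ν k) = (ν k : ℤ) ^ 2 - (2 * a + l - 1) * ν k + a * (l + a - 1) := by intro k; simp only [hg]; ring
      simp only [this, Finset.sum_add_distrib, Finset.sum_sub_distrib, Finset.mul_sum]; simp
    have f2 : ∑ k ∈ Finset.range m, g (nu0 l a k) = (∑ k ∈ Finset.range m, (nu0 l a k : ℤ) ^ 2) - (2 * a + l - 1) * (∑ k ∈ Finset.range m, (nu0 l a k : ℤ)) + m * (a * (l + a - 1)) := by
      have : ∀ k, g (nu0 l a k) = (nu0 l a k : ℤ) ^ 2 - (2 * a + l - 1) * nu0 l a k + a * (l + a - 1) := by intro k; simp only [hg]; ring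
      simp only [this, Finset.sum_add_distrib, Finset.sum_sub_distrib, Finset.mul_sum]; simp
    rw [f1, f2, h2, h1, nu0_sum l a m h, nu0_sum2 l a m h, Fin.sum_univ_eq_sum_range (fun j => (j : ℤ)), Fin.sum_univ_eq_sum_range (fun j => (j : ℤ) ^ 2)]
    ring
  have mA0 : ∀ x, x < l + m → (x ∈ A0 ↔ (x < a ∨ a + l ≤ x)) := by
    intro x hx
    simp only [hA0, Finset.mem_image, Finset.mem_range]
    constructor
    · rintro ⟨j, hj, rfl⟩; unfold nu0; split_ifs <;> omega
    · rintro (hx' | hx')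
      · exact ⟨x, by omega, by simp [nu0, hx']⟩
      · exact ⟨x - l, by omega, by unfold nu0; split_ifs <;> omega⟩
  have e2 : ∑ x ∈ A \ A0, g x = ∑ x ∈ A0 \ A, g x := by
    have i1 := Finset.sum_inter_add_sum_sdiff A A0 g
    have i2 := Finset.sum_inter_add_sum_sdiff A0 A g
    rw [Finset.inter_comm] at i2
    linarith
  have e3 : ∑ x ∈ A \ A0, g x ≤ 0 := by
    apply Finset.sum_nonpos
    intro x hx
    rw [Finset.mem_sdiff] at hx
    have hxl : x < l + m := by
      obtain ⟨k, _, rfl⟩ := Finset.mem_image.1 hx.1; exact hlt k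
    have := hx.2; rw [mA0 x hxl] at this
    have : a ≤ x ∧ x < a + l := by omega
    simp only [hg]
    apply mul_nonpos_of_nonneg_of_nonpos <;> omega
  have e4 : A0 \ A = ∅ := by
    by_contra hne
    have : 0 < ∑ x ∈ A0 \ A, g x := by
      apply Finset.sum_pos
      · intro x hx
        rw [Finset.mem_sdiff] at hx
        have hxl : x < l + m := by
          obtain ⟨k, hk, rfl⟩ := Finset.mem_image.1 hx.1
          have := Finset.mem_range.1 hk
          unfold nu0; split_ifs <;> omega
        have := hx.1; rw [mA0 x hxl] at this
        simp only [hg]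
        rcases this with h | h
        · apply mul_pos_of_neg_of_neg
          · omega
          · omega
        · apply mul_pos
          · omega
          · omega
      · exact Finset.nonempty_iff_ne_empty.2 hne
    omega
  have e5 : A0 = A := Finset.eq_of_subset_of_card_le (Finset.sdiff_eq_empty_iff_subset.1 e4) (by omega)
  have : ∀ k, ∃ j : Fin m, ν k = nu0 l a j := by
    intro k
    have : ν k ∈ A0 := by rw [e5, hA]; simp
    obtain ⟨j, hj, e⟩ := Finset.mem_image.1 this
    exact ⟨⟨j, Finset.mem_range.1 hj⟩, e.symm⟩
  choose f hf using this
  have fi : Function.Injective f := fun i j e => hinj (by rw [hf, hf, e])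
  exact ⟨Equiv.ofBijective f (Finite.injective_iff_bijective.1 fi), fun k => by simp [hf]⟩

section
variable {l m : ℕ}

theorem degreeOf_det_le {n : ℕ} (k : Fin m) (M : Matrix (Fin n) (Fin n) (MvPolynomial (Fin m) ℂ)) (d : Fin n → ℕ)
    (h : ∀ i j, (M i j).degreeOf k ≤ d i) : M.det.degreeOf k ≤ ∑ i, d i := by
  rw [← Matrix.det_transpose, det_apply]
  refine (MvPolynomial.degreeOf_sum_le _ _ _).trans (Finset.sup_le fun σ _ => ?_)
  have : (∏ i, Mᵀ (σ i) i).degreeOf k ≤ ∑ i, d i :=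
    (MvPolynomial.degreeOf_prod_le _ _ _).trans (Finset.sum_le_sum fun i _ => h i (σ i))
  rcases Int.units_eq_one_or (Equiv.Perm.sign σ) with e | e
  · rw [e, one_smul]; exact this
  · rw [e, Units.neg_smul, one_smul, MvPolynomial.degreeOf_neg]; exact this

theorem ev_SS (U : Matrix (Fin l) (Fin l) ℂ) : ev U (SS l m) =
    (vandermonde (MvPolynomial.X : Fin m → MvPolynomial (Fin m) ℂ)).det *
    ∏ k, (U.map MvPolynomial.C - (MvPolynomial.X k : MvPolynomial (Fin m) ℂ) • 1).det := by
  rw [SS, map_mul, map_prod]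
  simp only [ev_XM]
  congr 1
  rw [AlgHom.map_det]
  congr 1
  ext1 p q
  simp only [AlgHom.mapMatrix_apply, Matrix.map_apply, vandermonde_apply, map_pow]
  rw [bX, ev, MvPolynomial.aeval_X]; rfl

theorem ev_deg (U : Matrix (Fin l) (Fin l) ℂ) (k : Fin m) : (ev U (SS l m)).degreeOf k < l + m := by
  rw [ev_SS]
  have h1 : (vandermonde (MvPolynomial.X : Fin m → MvPolynomial (Fin m) ℂ)).det.degreeOf k ≤ m - 1 := by
    refine (degreeOf_det_le k _ (fun i => if i = k then m - 1 else 0) ?_).trans (by simp)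
    intro i j
    rw [vandermonde_apply]
    by_cases h : i = k
    · subst h
      rw [MvPolynomial.degreeOf_X_self_pow]; simp; omega
    · rw [MvPolynomial.degreeOf_X_pow_of_ne _ (Ne.symm h)]; simp
  have h2 : (∏ j, (U.map MvPolynomial.C - (MvPolynomial.X j : MvPolynomial (Fin m) ℂ) • 1).det).degreeOf k ≤ l := by
    refine (MvPolynomial.degreeOf_prod_le _ _ _).trans ?_
    have : ∀ j : Fin m, (U.map MvPolynomial.C - (MvPolynomial.X j : MvPolynomial (Fin m) ℂ) • 1).det.degreeOf k ≤
        if j = k then l else 0 := by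
      intro j
      refine (degreeOf_det_le k _ (fun _ => if j = k then 1 else 0) ?_).trans (by simp)
      intro p q
      simp only [Matrix.sub_apply, Matrix.map_apply, Matrix.smul_apply, smul_eq_mul]
      refine (MvPolynomial.degreeOf_sub_le _ _ _).trans ?_
      rw [MvPolynomial.degreeOf_C]
      by_cases hpq : p = q
      · subst hpq
        rw [Matrix.one_apply_eq, mul_one, MvPolynomial.degreeOf_X]
        simp [eq_comm]
      · rw [Matrix.one_apply_ne hpq, mul_zero]; simp
    exact (Finset.sum_le_sum fun j _ => this j).trans (by simp)
  have := MvPolynomial.degreeOf_mul_le k (vandermonde (MvPolynomial.X : Fin m → MvPolynomial (Fin m) ℂ)).det (∏ j, (U.map MvPolynomial.C - (MvPolynomial.X j : MvPolynomial (Fin m) ℂ) • 1).det)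
  have := k.2
  omega

noncomputable def box (l m : ℕ) : Finset (Fin m →₀ ℕ) := Finset.Icc 0 (Finsupp.equivFunOnFinite.symm (fun _ => l + m - 1))

theorem mem_box (ν : Fin m →₀ ℕ) : ν ∈ box l m ↔ ∀ k, ν k < l + m := by
  simp only [box, Finset.mem_Icc, zero_le, true_and]
  rw [Finsupp.le_def]
  refine forall_congr' fun k => ?_
  have := k.2
  simp; omega

variable (μ : Measure (Matrix.unitaryGroup (Fin l) ℂ)) [μ.IsHaarMeasure] [IsProbabilityMeasure μ]

noncomputable def HH (m a : ℕ) : MvPolynomial (Fin m) ℂ := ∑ ν ∈ box l m, MvPolynomial.monomial ν (lam μ a ν (SS l m))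

noncomputable def GG (a : ℕ) (β : Fin m → ℂ) : ℂ :=
  ∫ U : Matrix.unitaryGroup (Fin l) ℂ, (star (U : Matrix (Fin l) (Fin l) ℂ).det) ^ a *
    ∏ k, ((U : Matrix (Fin l) (Fin l) ℂ) - β k • 1).det ∂μ

theorem HH_coeff (a : ℕ) (ν : Fin m →₀ ℕ) : (HH μ m a).coeff ν = if ν ∈ box l m then lam μ a ν (SS l m) else 0 := by
  classical
  rw [HH, MvPolynomial.coeff_sum]
  simp only [MvPolynomial.coeff_monomial]
  rw [Finset.sum_ite_eq']

theorem ev_eval (U : Matrix (Fin l) (Fin l) ℂ) (β : Fin m → ℂ) :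
    ∑ ν ∈ box l m, (ev U (SS l m)).coeff ν * ∏ i, β i ^ ν i = (vandermonde β).det * ∏ k, (U - β k • 1).det := by
  rw [← Finset.sum_subset (s₁ := (ev U (SS l m)).support), ← MvPolynomial.eval_eq', ev_SS, map_mul, map_prod, RingHom.map_det]
  · congr 1
    · congr 1; ext1 p q; simp [vandermonde_apply]
    · refine Finset.prod_congr rfl fun k _ => ?_
      rw [RingHom.map_det]
      congr 1; ext1 p q
      by_cases h : p = q
      · subst h; simp
      · simp [h]
  · intro ν hν
    rw [mem_box]
    intro k
    exact (MvPolynomial.monomial_le_degreeOf k hν).trans_lt (ev_deg U k)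
  · intro ν _ h
    rw [MvPolynomial.notMem_support_iff.1 h, zero_mul]

theorem HH_eval (a : ℕ) (β : Fin m → ℂ) : MvPolynomial.eval β (HH μ m a) = (vandermonde β).det * GG μ a β := by
  rw [HH, map_sum]
  simp only [MvPolynomial.eval_monomial, lam, LinearMap.coe_mk, AddHom.coe_mk, Finsupp.prod_pow]
  rw [GG, ← integral_const_mul]
  simp only [← integral_mul_const]
  rw [← integral_finsetSum]
  · congr 1; ext U
    rw [mul_left_comm, ← ev_eval, Finset.mul_sum]
    exact Finset.sum_congr rfl fun ν _ => by ring
  · intro ν _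
    exact (u_int μ _ (lam_cont a ν (SS l m))).mul_const _

theorem HH_perm (a : ℕ) (σ : Equiv.Perm (Fin m)) (ν : Fin m →₀ ℕ) :
    (HH μ m a).coeff (Finsupp.mapDomain σ ν) = ((Equiv.Perm.sign σ : ℤ) : ℂ) * (HH μ m a).coeff ν := by
  have h1 : MvPolynomial.rename σ (HH μ m a) = MvPolynomial.C ((Equiv.Perm.sign σ : ℤ) : ℂ) * HH μ m a := by
    apply MvPolynomial.funext
    intro β
    rw [MvPolynomial.eval_rename, map_mul, MvPolynomial.eval_C, HH_eval, HH_eval, ← mul_assoc]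
    congr 1
    · rw [← Matrix.det_permute]; rfl
    · simp only [GG]
      congr 1; ext U
      congr 1
      exact Equiv.prod_comp σ (fun k => ((U : Matrix (Fin l) (Fin l) ℂ) - β k • 1).det)
  have h2 := MvPolynomial.coeff_rename_mapDomain σ σ.injective (HH μ m a) ν
  rw [h1, MvPolynomial.coeff_C_mul] at h2
  rw [← h2, ← mul_assoc, ← Int.cast_mul, Int.units_coe_mul_self]; simp

noncomputable def nuF (l m a : ℕ) : Fin m →₀ ℕ := Finsupp.equivFunOnFinite.symm (fun j : Fin m => nu0 l a j)

theorem HH_supp (hl : 1 ≤ l) (a : ℕ) (ha : a ≤ m) (ν : Fin m →₀ ℕ) (h : (HH μ m a).coeff ν ≠ 0) :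
    ∃ σ : Equiv.Perm (Fin m), ν = Finsupp.mapDomain σ (nuF l m a) := by
  have hc := HH_coeff μ a ν
  have hb : ν ∈ box l m := by
    by_contra hb; rw [if_neg hb] at hc; exact h hc
  rw [if_pos hb] at hc
  have hlam : lam μ a ν (SS l m) ≠ 0 := hc ▸ h
  have hinj : Function.Injective ν := by
    intro i j hij
    by_contra hne
    have h1 := HH_perm μ a (Equiv.swap i j) ν
    have h2 : Finsupp.mapDomain (Equiv.swap i j) ν = ν := by
      ext k
      rw [Finsupp.mapDomain_equiv_apply, Equiv.symm_swap]
      by_cases h1 : k = i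
      · subst h1; rw [Equiv.swap_apply_left, hij]
      · by_cases h2 : k = j
        · subst h2; rw [Equiv.swap_apply_right, hij]
        · rw [Equiv.swap_apply_of_ne_of_ne h1 h2]
    rw [h2, Equiv.Perm.sign_swap hne] at h1
    apply h
    simp at h1
    linear_combination (1 / 2 : ℂ) * h1
  obtain ⟨σ, hσ⟩ := comb_perm l a m hl ha ν hinj ((mem_box ν).1 hb) (supp1 μ a ν hlam) (supp2 μ a ν hlam)
  refine ⟨σ⁻¹, ?_⟩
  ext k
  rw [Finsupp.mapDomain_equiv_apply, hσ]
  rfl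

theorem main_alt (hl : 1 ≤ l) (a : ℕ) (ha : a ≤ m) : ∃ c : ℂ, ∀ β : Fin m → ℂ,
    (vandermonde β).det * GG μ a β = c * (Matrix.of fun k j : Fin m => β k ^ nu0 l a j).det := by
  classical
  refine ⟨(HH μ m a).coeff (nuF l m a), fun β => ?_⟩
  rw [← HH_eval, MvPolynomial.eval_eq']
  have hinj : Function.Injective fun σ : Equiv.Perm (Fin m) => Finsupp.mapDomain σ (nuF l m a) := by
    intro σ τ h
    have : σ.symm = τ.symm := by
      ext1 k
      have := DFunLike.congr_fun h k
      simp only [Finsupp.mapDomain_equiv_apply] at this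
      exact Fin.ext (nu0_inj l a this)
    exact Equiv.symm_bijective.injective this
  rw [Finset.sum_subset (s₂ := Finset.univ.image fun σ : Equiv.Perm (Fin m) => Finsupp.mapDomain σ (nuF l m a))]
  · rw [Finset.sum_image fun _ _ _ _ e => hinj e, det_apply, Finset.mul_sum]
    refine Finset.sum_congr rfl fun σ _ => ?_
    rw [HH_perm, Units.smul_def, zsmul_eq_mul]
    have : ∏ i, β i ^ (Finsupp.mapDomain σ (nuF l m a)) i = ∏ i, β (σ i) ^ nu0 l a i := by
      rw [← Equiv.prod_comp σ (fun i => β i ^ (Finsupp.mapDomain σ (nuF l m a)) i)]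
      refine Finset.prod_congr rfl fun i _ => ?_
      rw [Finsupp.mapDomain_equiv_apply, Equiv.symm_apply_apply]; rfl
    rw [this]
    simp only [Matrix.of_apply]
    ring
  · intro ν hν
    obtain ⟨σ, hσ⟩ := HH_supp μ hl a ha ν (MvPolynomial.mem_support_iff.1 hν)
    exact Finset.mem_image.2 ⟨σ, Finset.mem_univ _, hσ.symm⟩
  · intro ν _ h
    rw [MvPolynomial.notMem_support_iff.1 h, zero_mul]
end

section
variable {l m : ℕ}

/-- position map -/
def posF (l m a : ℕ) (ha : a ≤ m) : Fin m ⊕ Fin l → Fin (m + l) :=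
  Sum.elim (fun i => ⟨nu0 l a i, by unfold nu0; split_ifs <;> omega⟩) (fun j => ⟨a + j, by omega⟩)

theorem posF_bij (l m a : ℕ) (ha : a ≤ m) : Function.Bijective (posF l m a ha) := by
  rw [Fintype.bijective_iff_injective_and_card]
  constructor
  · rintro (i | i) (j | j) h
    · simp only [posF, Sum.elim_inl, Fin.mk.injEq] at h
      rw [Fin.ext (nu0_inj l a h)]
    · simp only [posF, Sum.elim_inl, Sum.elim_inr, Fin.mk.injEq, nu0] at h
      split_ifs at h <;> omega
    · simp only [posF, Sum.elim_inl, Sum.elim_inr, Fin.mk.injEq, nu0] at h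
      split_ifs at h <;> omega
    · simp only [posF, Sum.elim_inr, Fin.mk.injEq] at h
      rw [Fin.ext (Nat.add_left_cancel h)]
  · simp

noncomputable def pp (β : Fin m → ℂ) : Polynomial ℂ := ∏ i, (Polynomial.X - Polynomial.C (β i))

theorem pp_monic (β : Fin m → ℂ) : (pp β).Monic := Polynomial.monic_prod_of_monic _ _ fun i _ => Polynomial.monic_X_sub_C _
theorem pp_deg (β : Fin m → ℂ) : (pp β).natDegree = m := by
  rw [pp, Polynomial.natDegree_prod_of_monic _ _ fun i _ => Polynomial.monic_X_sub_C _]; simp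

noncomputable def qb (l : ℕ) (β : Fin m → ℂ) : Fin m ⊕ Fin l → Polynomial ℂ :=
  Sum.elim (fun i => Polynomial.X ^ (i : ℕ)) (fun j => Polynomial.X ^ (j : ℕ) * pp β)

theorem qb_monic (β : Fin m → ℂ) (c : Fin m ⊕ Fin l) : (qb l β c).Monic := by
  rcases c with i | j
  · exact Polynomial.monic_X_pow _
  · exact (Polynomial.monic_X_pow _).mul (pp_monic β)

theorem qb_deg (β : Fin m → ℂ) (c : Fin m ⊕ Fin l) : (qb l β c).natDegree = (finSumFinEquiv c : ℕ) := by
  rcases c with i | j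
  · simp [qb]
  · simp only [qb, Sum.elim_inr]
    rw [(Polynomial.monic_X_pow _).natDegree_mul (pp_monic β), pp_deg]; simp; omega

noncomputable def TT (l a : ℕ) (β : Fin m → ℂ) : ℂ :=
  (Matrix.of fun j k : Fin l => (Polynomial.X ^ (k : ℕ) * pp β).coeff (a + j)).det

theorem block_det (l m a : ℕ) (ha : a ≤ m) : ∃ ε : ℂ, ∀ β : Fin m → ℂ, 
    (Matrix.of fun k j : Fin m => β k ^ nu0 l a j).det = ε * ((vandermonde β).det * TT l a β) := by
  set e := Equiv.ofBijective _ (posF_bij l m a ha) with he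
  set f : Fin m ⊕ Fin l ≃ Fin (m + l) := finSumFinEquiv with hf
  set σ : Equiv.Perm (Fin m ⊕ Fin l) := e.trans f.symm with hσ
  refine ⟨((Equiv.Perm.sign σ : ℤ) : ℂ), fun β => ?_⟩
  set Mt : Matrix (Fin (m + l)) (Fin (m + l)) ℂ := Matrix.of fun n n' => (qb l β (f.symm n')).coeff n with hMt
  have hM : Mt.det = 1 := by
    rw [Matrix.det_of_upperTriangular]
    · refine Finset.prod_eq_one fun n _ => ?_
      simp only [hMt, Matrix.of_apply]
      have h1 := qb_deg β (f.symm n)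
      have h2 := qb_monic β (f.symm n)
      rw [← hf, Equiv.apply_symm_apply] at h1
      rw [← h1]; exact h2
    · intro n n' h
      simp only [hMt, Matrix.of_apply]
      apply Polynomial.coeff_eq_zero_of_natDegree_lt
      rw [qb_deg, ← hf, Equiv.apply_symm_apply]
      exact h
  set E0 : Matrix (Fin m ⊕ Fin l) (Fin m ⊕ Fin l) ℂ := Matrix.fromBlocks
    (Matrix.of fun k j : Fin m => β k ^ nu0 l a j) (Matrix.of fun (k : Fin m) (j : Fin l) => β k ^ (a + j : ℕ)) 0 1 with hE0
  set E1 : Matrix (Fin m ⊕ Fin l) (Fin m ⊕ Fin l) ℂ := Matrix.fromBlocks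
    (vandermonde β) 0 (Matrix.of fun (j : Fin l) (k : Fin m) => (Polynomial.X ^ (k : ℕ) : Polynomial ℂ).coeff (a + j))
      (Matrix.of fun j k : Fin l => (Polynomial.X ^ (k : ℕ) * pp β).coeff (a + j)) with hE1
  have d0 : E0.det = (Matrix.of fun k j : Fin m => β k ^ nu0 l a j).det := by
    rw [hE0, Matrix.det_fromBlocks_zero₂₁, Matrix.det_one, mul_one]
  have d1 : E1.det = (vandermonde β).det * TT l a β := by
    rw [hE1, Matrix.det_fromBlocks_zero₁₂]; rfl
  have hC : (Mt.submatrix e f).det = ((Equiv.Perm.sign σ : ℤ) : ℂ) := by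
    have : Mt.submatrix e f = (Mt.submatrix f f).submatrix σ id := by
      ext1 p q; simp [hσ]
    rw [this, Matrix.det_permute, Matrix.det_submatrix_equiv_self, hM, mul_one]
  have hval : ∀ (k : Fin m) c, (qb l β c).eval (β k) = E1 (Sum.inl k) c := by
    intro k c
    rcases c with i | j
    · simp [qb, hE1, vandermonde_apply]
    · simp only [qb, hE1, Sum.elim_inr, Matrix.fromBlocks_apply₁₂, Matrix.zero_apply, Polynomial.eval_mul]
      rw [pp, Polynomial.eval_prod, Finset.prod_eq_zero (Finset.mem_univ k) (by simp), mul_zero]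
  have hprod : E0 * Mt.submatrix e f = E1 := by
    ext1 r c
    rw [Matrix.mul_apply]
    have hq : ∀ c', Mt.submatrix e f c' c = (qb l β c).coeff (e c') := by
      intro c'; simp [hMt]
    simp only [hq]
    rcases r with k | j
    · rw [← hval, Polynomial.eval_eq_sum_range' (n := m + l) (by rw [qb_deg]; exact Fin.is_lt _),
        ← Fin.sum_univ_eq_sum_range (fun n => (qb l β c).coeff n * β k ^ n), ← Equiv.sum_comp e]
      refine Finset.sum_congr rfl fun c' _ => ?_
      rw [mul_comm]; congr 1
      rcases c' with i | j <;> simp [hE0, he, posF]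
    · rw [Finset.sum_eq_single (Sum.inr j)]
      · have : ((e (Sum.inr j) : Fin (m + l)) : ℕ) = a + j := by simp [he, posF]
        rw [this]
        rcases c with i | j' <;> simp [hE0, hE1, qb]
      · rintro (i | j') _ hne
        · simp [hE0]
        · have : j ≠ j' := fun h => hne (by rw [h])
          simp [hE0, this]
      · simp
  rw [← d0, ← d1, ← hprod, Matrix.det_mul, hC, mul_left_comm, ← Int.cast_mul, Int.units_coe_mul_self]
  simp
end

section
open Filter Topology

section
variable {l m : ℕ}
variable (μ : Measure (Matrix.unitaryGroup (Fin l) ℂ)) [μ.IsHaarMeasure] [IsProbabilityMeasure μ]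

theorem u_param {X : Type*} [TopologicalSpace X] [FirstCountableTopology X] [LocallyCompactSpace X]
    (f : X → Matrix.unitaryGroup (Fin l) ℂ → ℂ) (hf : Continuous f.uncurry) :
    Continuous fun x => ∫ U, f x U ∂μ := by
  have := continuous_parametric_integral_of_continuous (μ := μ) hf isCompact_univ
  simpa using this

theorem GG_cont (a : ℕ) : Continuous (GG μ a (m := m)) := by
  unfold GG
  apply u_param
  unfold Function.uncurry
  have h0 : Continuous fun p : (Fin m → ℂ) × Matrix.unitaryGroup (Fin l) ℂ => (p.2 : Matrix (Fin l) (Fin l) ℂ) :=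
    continuous_subtype_val.comp continuous_snd
  refine Continuous.mul ((continuous_star.comp h0.matrix_det).pow a) (continuous_finsetProd _ fun k _ => Continuous.matrix_det ?_)
  have hk : Continuous fun p : (Fin m → ℂ) × Matrix.unitaryGroup (Fin l) ℂ => p.1 k :=
    (continuous_apply k).comp continuous_fst
  have h1 : Continuous fun p : (Fin m → ℂ) × Matrix.unitaryGroup (Fin l) ℂ => p.1 k • (1 : Matrix (Fin l) (Fin l) ℂ) :=
    hk.smul continuous_const
  exact h0.sub h1

theorem pp_cont (n : ℕ) : Continuous fun β : Fin m → ℂ => (pp β).coeff n := by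
  unfold pp
  generalize (Finset.univ : Finset (Fin m)) = s
  induction s using Finset.induction_on generalizing n with
  | empty => simp only [Finset.prod_empty]; exact continuous_const
  | insert i s hi ih =>
    simp only [Finset.prod_insert hi, sub_mul, Polynomial.coeff_sub, Polynomial.coeff_C_mul]
    refine Continuous.sub ?_ ((continuous_apply i).mul (ih n))
    cases n with
    | zero => simp only [Polynomial.coeff_X_mul_zero]; exact continuous_const
    | succ n => simp only [Polynomial.coeff_X_mul]; exact ih n

theorem TT_cont (l a : ℕ) : Continuous (TT l a (m := m)) := by
  unfold TT
  refine Continuous.matrix_det (continuous_matrix fun j k => ?_)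
  simp only [Matrix.of_apply, Polynomial.coeff_X_pow_mul']
  split_ifs
  · exact pp_cont _
  · exact continuous_const

theorem GG_eq (hl : 1 ≤ l) (a : ℕ) (ha : a ≤ m) : ∃ c : ℂ, ∀ β : Fin m → ℂ, GG μ a β = c * TT l a β := by
  obtain ⟨c, hc⟩ := main_alt μ hl a ha
  obtain ⟨ε, hε⟩ := block_det l m a ha
  refine ⟨c * ε, fun β => ?_⟩
  have hgood : ∀ β : Fin m → ℂ, Function.Injective β → GG μ a β = (c * ε) * TT l a β := by
    intro β hβ
    have h := hc β
    rw [hε] at h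
    apply mul_left_cancel₀ (Matrix.det_vandermonde_ne_zero_iff.2 hβ)
    rw [h]; ring
  have hp : Continuous fun t : ℂ => (fun k : Fin m => β k + t * (k : ℕ) : Fin m → ℂ) := by fun_prop
  have h1 : Tendsto (fun t : ℂ => GG μ a (fun k : Fin m => β k + t * (k : ℕ))) (𝓝[≠] 0) (𝓝 (GG μ a β)) := by
    have := ((GG_cont μ a (m := m)).comp hp).tendsto 0
    simp only [Function.comp_def, zero_mul, add_zero] at this
    exact this.mono_left nhdsWithin_le_nhds
  have h2 : Tendsto (fun t : ℂ => (c * ε) * TT l a (fun k : Fin m => β k + t * (k : ℕ))) (𝓝[≠] 0) (𝓝 ((c * ε) * TT l a β)) := by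
    have := (((TT_cont l a (m := m)).comp hp).tendsto 0).const_mul (c * ε)
    simp only [Function.comp_def, zero_mul, add_zero] at this
    exact this.mono_left nhdsWithin_le_nhds
  refine tendsto_nhds_unique h1 (h2.congr' ?_)
  have h3 : ∀ i j : Fin m, ∀ᶠ t : ℂ in 𝓝[≠] 0, i ≠ j → β i + t * (i : ℕ) ≠ β j + t * (j : ℕ) := by
    intro i j
    by_cases hij : i = j
    · exact Filter.Eventually.of_forall fun t h => absurd hij h
    · by_cases hb : β i = β j
      · filter_upwards [self_mem_nhdsWithin] with t ht _ h
        rw [hb] at h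
        have h := mul_left_cancel₀ (show t ≠ 0 from ht) (add_left_cancel h)
        exact hij (Fin.ext (by exact_mod_cast h))
      · have c1 : Continuous fun t : ℂ => β i + t * (i : ℕ) := by fun_prop
        have c2 : Continuous fun t : ℂ => β j + t * (j : ℕ) := by fun_prop
        have := (isOpen_ne_fun c1 c2).mem_nhds (x := 0) (by simpa using hb)
        exact mem_nhdsWithin_of_mem_nhds (Filter.mem_of_superset this fun t h _ => h)
  have h4 := Filter.eventually_all.2 fun i => Filter.eventually_all.2 (h3 i)
  filter_upwards [h4] with t ht
  symm
  apply hgood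
  intro i j h
  by_contra hne
  exact ht i j hne h

theorem star_det_mul (U : Matrix.unitaryGroup (Fin l) ℂ) (s : ℂ) :
    star (U : Matrix (Fin l) (Fin l) ℂ).det * ((U : Matrix (Fin l) (Fin l) ℂ) + s • 1).det =
      (1 + s • star (U : Matrix (Fin l) (Fin l) ℂ)).det := by
  rw [← Matrix.det_conjTranspose, ← Matrix.det_mul]
  congr 1
  have := Matrix.mem_unitaryGroup_iff'.1 U.2
  rw [Matrix.mul_add, ← Matrix.star_eq_conjTranspose, this]
  simp

noncomputable def FF (N : ℕ) (s : ℂ) : ℂ := ∫ U : Matrix.unitaryGroup (Fin l) ℂ,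
  (1 + s • star (U : Matrix (Fin l) (Fin l) ℂ)).det ^ N * (1 + s • (U : Matrix (Fin l) (Fin l) ℂ)).det ^ N ∂μ

noncomputable def fP (N : ℕ) (s : ℂ) : Polynomial ℂ := (Polynomial.X + Polynomial.C s) ^ N * (1 + Polynomial.C s * Polynomial.X) ^ N

noncomputable def DD (l N : ℕ) (s : ℂ) : ℂ :=
  (Matrix.of fun j k : Fin l => (Polynomial.X ^ (k : ℕ) * fP N s).coeff (N + j)).det

theorem FF_pre (hl : 1 ≤ l) (N : ℕ) : ∃ c : ℂ, ∀ s : ℂ, s ≠ 0 → FF μ N s = c * DD l N s := by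
  obtain ⟨c, hc⟩ := GG_eq μ hl (m := N + N) N (by omega)
  refine ⟨c, fun s hs => ?_⟩
  have h := hc (Fin.append (fun _ => -s) (fun _ => -s⁻¹))
  have h1 : FF μ N s = s ^ (l * N) * GG μ N (Fin.append (fun _ : Fin N => -s) (fun _ : Fin N => -s⁻¹)) := by
    rw [FF, GG, ← integral_const_mul]
    congr 1; ext U
    rw [Fin.prod_univ_add]
    simp only [Fin.append_left, Fin.append_right, Finset.prod_const, Finset.card_univ, Fintype.card_fin, neg_smul, sub_neg_eq_add]
    rw [← star_det_mul]
    have : 1 + s • (U : Matrix (Fin l) (Fin l) ℂ) = s • ((U : Matrix (Fin l) (Fin l) ℂ) + s⁻¹ • 1) := by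
      rw [smul_add, smul_smul, mul_inv_cancel₀ hs, one_smul, add_comm]
    rw [this, Matrix.det_smul, Fintype.card_fin, mul_pow, mul_pow, pow_mul]
    ring
  have h2 : DD l N s = s ^ (l * N) * TT l N (Fin.append (fun _ : Fin N => -s) (fun _ : Fin N => -s⁻¹)) := by
    have e : fP N s = Polynomial.C (s ^ N) * pp (Fin.append (fun _ : Fin N => -s) (fun _ : Fin N => -s⁻¹)) := by
      rw [fP, pp, Fin.prod_univ_add]
      simp only [Fin.append_left, Fin.append_right, Finset.prod_const, Finset.card_univ, Fintype.card_fin]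
      rw [mul_left_comm, map_pow, ← mul_pow (Polynomial.C s), map_neg, map_neg, sub_neg_eq_add, sub_neg_eq_add]
      congr 2
      rw [mul_add, ← Polynomial.C_mul, mul_inv_cancel₀ hs, Polynomial.C_1, add_comm]
    rw [DD, TT]
    have e2 : (Matrix.of fun j k : Fin l => (Polynomial.X ^ (k : ℕ) * fP N s).coeff (N + j)) =
      (s ^ N) • Matrix.of fun j k : Fin l => (Polynomial.X ^ (k : ℕ) * pp (Fin.append (fun _ : Fin N => -s) (fun _ : Fin N => -s⁻¹))).coeff (N + j) := by
      ext1 j k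
      rw [Matrix.smul_apply, Matrix.of_apply, Matrix.of_apply, e, mul_left_comm, Polynomial.coeff_C_mul, smul_eq_mul]
    rw [e2, Matrix.det_smul, Fintype.card_fin, ← pow_mul, mul_comm l N]
  rw [h1, h2, h]; ring

theorem FF_cont (N : ℕ) : Continuous (FF μ N) := by
  unfold FF
  apply u_param
  unfold Function.uncurry
  have h0 : Continuous fun p : ℂ × Matrix.unitaryGroup (Fin l) ℂ => (p.2 : Matrix (Fin l) (Fin l) ℂ) :=
    continuous_subtype_val.comp continuous_snd
  have h1 : Continuous fun p : ℂ × Matrix.unitaryGroup (Fin l) ℂ => star (p.2 : Matrix (Fin l) (Fin l) ℂ) := h0.star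
  exact ((continuous_const.add (continuous_fst.smul h1)).matrix_det.pow N).mul
    ((continuous_const.add (continuous_fst.smul h0)).matrix_det.pow N)

theorem poly_cont_mul {p q : ℂ → Polynomial ℂ} (hp : ∀ n, Continuous fun s => (p s).coeff n)
    (hq : ∀ n, Continuous fun s => (q s).coeff n) (n : ℕ) : Continuous fun s => (p s * q s).coeff n := by
  simp only [Polynomial.coeff_mul]
  exact continuous_finsetSum _ fun x _ => (hp _).mul (hq _)

theorem poly_cont_pow {p : ℂ → Polynomial ℂ} (hp : ∀ n, Continuous fun s => (p s).coeff n) (N : ℕ)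
    (n : ℕ) : Continuous fun s => (p s ^ N).coeff n := by
  induction N generalizing n with
  | zero => simp only [pow_zero]; exact continuous_const
  | succ N ih => simp only [pow_succ]; exact poly_cont_mul ih hp n

theorem DD_cont (l N : ℕ) : Continuous (DD l N) := by
  unfold DD
  refine Continuous.matrix_det (continuous_matrix fun j k => ?_)
  simp only [Matrix.of_apply]
  refine poly_cont_mul (fun n => continuous_const) (fun n => ?_) _
  unfold fP
  refine poly_cont_mul (poly_cont_pow (fun n => ?_) N) (poly_cont_pow (fun n => ?_) N) n
  · simp only [Polynomial.coeff_add, Polynomial.coeff_C]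
    refine continuous_const.add ?_
    split_ifs
    · exact continuous_id
    · exact continuous_const
  · simp only [Polynomial.coeff_add, Polynomial.coeff_C_mul]
    exact continuous_const.add (continuous_id.mul continuous_const)

theorem FF_eq (hl : 1 ≤ l) (N : ℕ) (s : ℂ) : FF μ N s = DD l N s := by
  obtain ⟨c, hc⟩ := FF_pre μ hl N
  have h : ∀ s, FF μ N s = c * DD l N s := by
    intro s
    have hd : Dense ({0}ᶜ : Set ℂ) := dense_compl_singleton 0
    have := Continuous.ext_on hd (FF_cont μ N) (continuous_const.mul (DD_cont l N) (f := fun _ => c)) (fun s hs => hc s hs)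
    exact congrFun this s
  have h0 : FF μ N 0 = 1 := by simp [FF]
  have h1 : DD l N 0 = 1 := by
    rw [DD]
    have : (Matrix.of fun j k : Fin l => (Polynomial.X ^ (k : ℕ) * fP N 0).coeff (N + j)) = 1 := by
      ext1 j k
      simp only [fP, Matrix.of_apply, map_zero, add_zero, zero_mul, one_pow, mul_one, ← pow_add, Polynomial.coeff_X_pow, Matrix.one_apply]
      congr 1
      rw [eq_iff_iff, Fin.ext_iff]; omega
    rw [this, Matrix.det_one]
  have h2 := h 0
  rw [h0, h1, mul_one] at h2
  rw [h, ← h2, one_mul]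
end

end

section
open Filter Topology

noncomputable def tN (z : ℝ) (N j k i : ℕ) : ℝ :=
  (N.choose i * (z / N) ^ i) * (if k ≤ j + i then N.choose (j + i - k) * (z / N) ^ (j + i - k) else 0)

noncomputable def tI (z : ℝ) (j k i : ℕ) : ℝ :=
  (z ^ i / i.factorial) * (if k ≤ j + i then z ^ (j + i - k) / (j + i - k).factorial else 0)

theorem coeff_lin_pow (s : ℂ) (N n : ℕ) :
    ((1 + Polynomial.C s * Polynomial.X) ^ N).coeff n = N.choose n * s ^ n := by
  have : (1 + Polynomial.C s * Polynomial.X : Polynomial ℂ) ^ N = ((1 + Polynomial.X) ^ N : Polynomial ℂ).comp (Polynomial.C s * Polynomial.X) := by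
    simp
  rw [this, Polynomial.comp_C_mul_X_coeff, Polynomial.coeff_one_add_X_pow]

theorem coeff_fP (z : ℝ) (N j k : ℕ) :
    (Polynomial.X ^ k * fP N ((z / N : ℝ) : ℂ)).coeff (N + j) = ((∑' i, tN z N j k i : ℝ) : ℂ) := by
  have h0 : ∑' i, tN z N j k i = ∑ i ∈ Finset.range (N + 1), tN z N j k i := by
    apply tsum_eq_sum
    intro i hi
    have : N < i := by simpa using hi
    simp [tN, Nat.choose_eq_zero_of_lt this]
  rw [h0, fP, add_comm Polynomial.X, add_pow, Finset.sum_mul, Finset.mul_sum, Polynomial.finsetSum_coeff, Complex.ofReal_sum]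
  refine Finset.sum_congr rfl fun i hi => ?_
  have hi : i ≤ N := by simpa [Nat.lt_succ_iff] using hi
  generalize hq : (1 + Polynomial.C ((z / N : ℝ) : ℂ) * Polynomial.X) ^ N = q
  have hqc : ∀ n, q.coeff n = N.choose n * ((z / N : ℝ) : ℂ) ^ n := fun n => by rw [← hq, coeff_lin_pow]
  have e : (Polynomial.X ^ k * (Polynomial.C ((z / N : ℝ) : ℂ) ^ i * Polynomial.X ^ (N - i) * (N.choose i : Polynomial ℂ) * q)) =
      Polynomial.C (N.choose i * ((z / N : ℝ) : ℂ) ^ i) * (Polynomial.X ^ (k + (N - i)) * q) := by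
    rw [pow_add, Polynomial.C_mul, Polynomial.C_pow, Polynomial.C_eq_natCast]; ring
  rw [e, Polynomial.coeff_C_mul, Polynomial.coeff_X_pow_mul', tN]
  by_cases h : k ≤ j + i
  · rw [if_pos h, if_pos (by omega), hqc]
    rw [show N + j - (k + (N - i)) = j + i - k by omega]
    push_cast; rfl
  · rw [if_neg h, if_neg (by omega)]; simp

theorem choose_bd (z : ℝ) (N i : ℕ) : |(N.choose i * (z / N) ^ i : ℝ)| ≤ |z| ^ i / i.factorial := by
  rcases Nat.eq_zero_or_pos N with rfl | hN
  · cases i with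
    | zero => simp
    | succ i => simp; positivity
  · have h := Nat.choose_le_pow_div (α := ℝ) i N
    have hN' : (0 : ℝ) < N := by exact_mod_cast hN
    rw [abs_mul, abs_pow, abs_div, Nat.abs_cast, Nat.abs_cast]
    calc (N.choose i : ℝ) * (|z| / N) ^ i ≤ ((N : ℝ) ^ i / i.factorial) * (|z| / N) ^ i := by gcongr
      _ = _ := by rw [div_pow]; field_simp

theorem choose_lim (z : ℝ) (i : ℕ) : Tendsto (fun N : ℕ => (N.choose i * (z / N) ^ i : ℝ)) atTop (𝓝 (z ^ i / i.factorial)) := by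
  apply ProbabilityTheory.tendsto_choose_mul_pow_atTop
  refine tendsto_const_nhds.congr' ?_
  filter_upwards [eventually_ne_atTop 0] with N hN
  field_simp

theorem tN_lim (z : ℝ) (j k : ℕ) : Tendsto (fun N : ℕ => ∑' i, tN z N j k i) atTop (𝓝 (∑' i, tI z j k i)) := by
  refine tendsto_tsum_of_dominated_convergence (bound := fun i => (|z| ^ i / i.factorial) * Real.exp |z|)
    ((Real.summable_pow_div_factorial |z|).mul_right _) (fun i => ?_) (Eventually.of_forall fun N i => ?_)
  · unfold tN tI
    refine (choose_lim z i).mul ?_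
    split_ifs
    · exact choose_lim z _
    · exact tendsto_const_nhds
  · rw [tN, Real.norm_eq_abs, abs_mul]
    refine mul_le_mul (choose_bd z N i) ?_ (abs_nonneg _) (by positivity)
    split_ifs
    · exact (choose_bd z N _).trans (Real.pow_div_factorial_le_exp _ (abs_nonneg _) _)
    · simp; positivity

theorem tI_eq (z : ℝ) (j k : ℕ) : ∑' i, tI z j k i = besselI ((j : ℝ) - k) (2 * z) := by
  rw [besselI]
  congr 1; ext i
  rw [tI, mul_div_cancel_left₀ _ (two_ne_zero)]
  by_cases h : k ≤ j + i
  · rw [if_pos h]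
    obtain ⟨e, he⟩ := Nat.exists_eq_add_of_le h
    have he' : (j : ℝ) + i = k + e := by exact_mod_cast he
    rw [show j + i - k = e by omega, show (j : ℝ) - k + 2 * i = ((i + e : ℕ) : ℝ) by push_cast; linarith,
      show (j : ℝ) - k + i + 1 = (e : ℝ) + 1 by linarith, Real.rpow_natCast, Real.Gamma_nat_eq_factorial, pow_add, div_mul_div_comm]
  · rw [if_neg h, mul_zero]
    obtain ⟨e, he⟩ := Nat.exists_eq_add_of_lt (not_le.1 h)
    have he' : (k : ℝ) = j + i + e + 1 := by exact_mod_cast he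
    rw [show (j : ℝ) - k + i + 1 = -(e : ℝ) by linarith, Real.Gamma_neg_nat_eq_zero]; simp

theorem DD_lim (l : ℕ) (z : ℝ) : Tendsto (fun N : ℕ => DD l N ((z / N : ℝ) : ℂ)) atTop
    (𝓝 ((Matrix.det (fun j k : Fin l => besselI (((j : ℕ) : ℝ) - ((k : ℕ) : ℝ)) (2 * z)) : ℝ) : ℂ)) := by
  have h : ∀ N : ℕ, DD l N ((z / N : ℝ) : ℂ) = ((Matrix.det (fun j k : Fin l => ∑' i, tN z N j k i) : ℝ) : ℂ) := by
    intro N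
    rw [DD]
    have := RingHom.map_det Complex.ofRealHom (Matrix.of fun j k : Fin l => ∑' i, tN z N j k i)
    simp only [coeff_fP]
    exact this.symm
  simp only [h]
  refine (Complex.continuous_ofReal.tendsto _).comp ?_
  have hd : Continuous fun M : Matrix (Fin l) (Fin l) ℝ => M.det := continuous_id.matrix_det
  refine (hd.tendsto _).comp ?_
  refine tendsto_pi_nhds.2 fun j => tendsto_pi_nhds.2 fun k => ?_
  rw [← tI_eq]
  exact tN_lim z j k

theorem det_bd {l : ℕ} (s : ℂ) (M : Matrix (Fin l) (Fin l) ℂ) (hM : ∀ i j, ‖M i j‖ ≤ 1) :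
    ‖(1 + s • M).det‖ ≤ Real.exp (l ^ 2 * ‖s‖) := by
  have h1 : ‖(1 + s • M).det‖ ≤ ∏ i, ∑ j, ‖(1 + s • M) i j‖ := by
    rw [← Matrix.det_transpose, Matrix.det_apply']
    refine (norm_sum_le _ _).trans ?_
    rw [Finset.prod_univ_sum, Fintype.piFinset_univ]
    calc ∑ σ : Equiv.Perm (Fin l), ‖((Equiv.Perm.sign σ : ℤ) : ℂ) * ∏ i, (1 + s • M)ᵀ (σ i) i‖
        = ∑ σ : Equiv.Perm (Fin l), ∏ i, ‖(1 + s • M) i (σ i)‖ := by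
          refine Finset.sum_congr rfl fun σ _ => ?_
          rw [norm_mul, norm_prod]
          rcases Int.units_eq_one_or (Equiv.Perm.sign σ) with h | h <;> simp [h]
      _ = ∑ f ∈ Finset.univ.map ⟨fun σ : Equiv.Perm (Fin l) => (σ : Fin l → Fin l), DFunLike.coe_injective⟩, ∏ i, ‖(1 + s • M) i (f i)‖ := by
          rw [Finset.sum_map]; rfl
      _ ≤ _ := Finset.sum_le_sum_of_subset_of_nonneg (Finset.subset_univ _) fun f _ _ => by positivity
  refine h1.trans ?_
  have h2 : ∀ i, ∑ j, ‖(1 + s • M) i j‖ ≤ Real.exp (l * ‖s‖) := by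
    intro i
    calc ∑ j, ‖(1 + s • M) i j‖ ≤ ∑ j, ((if i = j then 1 else 0) + ‖s‖) := by
          refine Finset.sum_le_sum fun j _ => ?_
          rw [Matrix.add_apply, Matrix.smul_apply, Matrix.one_apply]
          refine (norm_add_le _ _).trans (add_le_add ?_ ?_)
          · split_ifs <;> simp
          · rw [norm_smul]; exact mul_le_of_le_one_right (norm_nonneg _) (hM i j)
      _ = l * ‖s‖ + 1 := by rw [Finset.sum_add_distrib]; simp [add_comm]
      _ ≤ _ := Real.add_one_le_exp _
  refine (Finset.prod_le_prod (fun i _ => by positivity) fun i _ => h2 i).trans ?_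
  simp only [Finset.prod_const, Finset.card_univ, Fintype.card_fin]
  rw [← Real.exp_nat_mul]
  apply le_of_eq; congr 1; ring

theorem det_pow_bd {l : ℕ} (z : ℝ) (N : ℕ) (M : Matrix (Fin l) (Fin l) ℂ) (hM : ∀ i j, ‖M i j‖ ≤ 1) :
    ‖(1 + ((z / N : ℝ) : ℂ) • M).det ^ N‖ ≤ Real.exp (l ^ 2 * |z|) := by
  rw [norm_pow]
  refine (pow_le_pow_left₀ (norm_nonneg _) (det_bd _ M hM) N).trans ?_
  rw [← Real.exp_nat_mul]
  apply Real.exp_le_exp.2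
  rw [Complex.norm_real, Real.norm_eq_abs, abs_div, Nat.abs_cast]
  rcases Nat.eq_zero_or_pos N with rfl | hN
  · simp; positivity
  · apply le_of_eq; field_simp

theorem det_pow_lim {l : ℕ} (z : ℝ) (M : Matrix (Fin l) (Fin l) ℂ) :
    Tendsto (fun N : ℕ => (1 + ((z / N : ℝ) : ℂ) • M).det ^ N) atTop (𝓝 (Complex.exp (z * M.trace))) := by
  have hd := fun N : ℕ => congrArg (fun w : ℂ => w ^ N) ((Matrix.det_one_add_smul ((z / N : ℝ) : ℂ) M).trans (add_assoc _ _ _))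
  refine Tendsto.congr (fun N => (hd N).symm) ?_
  apply Complex.tendsto_one_add_pow_exp_of_tendsto
  set q := (1 + (Polynomial.X : Polynomial ℂ) • M.map Polynomial.C).det.divX.divX
  have h0 : Tendsto (fun N : ℕ => ((z / N : ℝ) : ℂ)) atTop (𝓝 0) := by
    have := (Complex.continuous_ofReal.tendsto _).comp (tendsto_const_div_atTop_nhds_zero_nat z)
    simpa [Function.comp_def] using this
  have h1 : Tendsto (fun N : ℕ => (z : ℂ) * M.trace + q.eval ((z / N : ℝ) : ℂ) * z * ((z / N : ℝ) : ℂ)) atTop (𝓝 (z * M.trace + q.eval 0 * z * 0)) :=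
    tendsto_const_nhds.add ((((q.continuous.tendsto 0).comp h0).mul tendsto_const_nhds).mul h0)
  rw [mul_zero, add_zero] at h1
  refine h1.congr' ?_
  filter_upwards [eventually_ne_atTop 0] with N hN
  have hN : (N : ℂ) ≠ 0 := by exact_mod_cast hN
  generalize q.eval ((z / N : ℝ) : ℂ) = w
  push_cast
  field_simp

theorem FF_lim {l : ℕ} (μ : Measure (Matrix.unitaryGroup (Fin l) ℂ)) [IsProbabilityMeasure μ] (z : ℝ) :
    Tendsto (fun N : ℕ => FF μ N ((z / N : ℝ) : ℂ)) atTop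
    (𝓝 (∫ U : Matrix.unitaryGroup (Fin l) ℂ,
        Complex.exp ((z : ℂ) * Matrix.trace ((U : Matrix (Fin l) (Fin l) ℂ)
          + star (U : Matrix (Fin l) (Fin l) ℂ))) ∂μ)) := by
  unfold FF
  refine tendsto_integral_of_dominated_convergence (fun _ => Real.exp (l ^ 2 * |z|) * Real.exp (l ^ 2 * |z|)) (fun N => ?_)
    (integrable_const _) (fun N => ?_) ?_
  · refine Continuous.aestronglyMeasurable ?_
    have h0 : Continuous fun U : Matrix.unitaryGroup (Fin l) ℂ => (U : Matrix (Fin l) (Fin l) ℂ) := continuous_subtype_val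
    have h1 : Continuous fun U : Matrix.unitaryGroup (Fin l) ℂ => star (U : Matrix (Fin l) (Fin l) ℂ) := h0.star
    have hc : Continuous fun M : Matrix (Fin l) (Fin l) ℂ => 1 + ((z / N : ℝ) : ℂ) • M := by fun_prop
    have h2 : Continuous fun U : Matrix.unitaryGroup (Fin l) ℂ => (1 + ((z / N : ℝ) : ℂ) • (U : Matrix (Fin l) (Fin l) ℂ)) :=
      hc.comp h0
    have h3 : Continuous fun U : Matrix.unitaryGroup (Fin l) ℂ => (1 + ((z / N : ℝ) : ℂ) • star (U : Matrix (Fin l) (Fin l) ℂ)) :=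
      hc.comp h1
    exact (h3.matrix_det.pow N).mul (h2.matrix_det.pow N)
  · refine Eventually.of_forall fun U => ?_
    have hU := entry_norm_bound_of_unitary U.2
    rw [norm_mul]
    refine mul_le_mul (det_pow_bd z N _ fun i j => ?_) (det_pow_bd z N _ hU) (norm_nonneg _) (Real.exp_pos _).le
    rw [Matrix.star_apply, norm_star]; exact hU j i
  · refine Eventually.of_forall fun U => ?_
    rw [Matrix.trace_add, mul_add, Complex.exp_add, mul_comm (Complex.exp _)]
    exact (det_pow_lim z _).mul (det_pow_lim z _)
end

/-- The average of `exp(z Tr(U + U†))` over the unitary group `U(l)` with normalized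
Haar measure equals the Toeplitz determinant `det[I_{j-k}(2z)]_{j,k=1,…,l}`. -/
theorem unitary_average_eq_toeplitz_det (l : ℕ) (hl : 1 ≤ l)
    (μ : Measure (Matrix.unitaryGroup (Fin l) ℂ)) [μ.IsHaarMeasure] [IsProbabilityMeasure μ]
    (z : ℝ) :
    ∫ U : Matrix.unitaryGroup (Fin l) ℂ,
        Complex.exp ((z : ℂ) * Matrix.trace ((U : Matrix (Fin l) (Fin l) ℂ)
          + star (U : Matrix (Fin l) (Fin l) ℂ))) ∂μ
    = ((Matrix.det (fun j k : Fin l => besselI (((j : ℕ) : ℝ) - ((k : ℕ) : ℝ)) (2 * z)) : ℝ) : ℂ) := by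
  have h := FF_lim μ z
  simp only [FF_eq μ hl] at h
  exact _root_.tendsto_nhds_unique h (DD_lim l z)
end

section
/- (Gessel's identity.) Let l ≥ 1 be an integer. For each integer N ≥ 1 let T_l(N) denote the number of permutations σ of {1,2,…,N} that contain no increasing subsequence of length l+1, i.e. there exist no indices i_1 < i_2 < ⋯ < i_{l+1} with σ(i_1) < σ(i_2) < ⋯ < σ(i_{l+1}). Then for every real z, det[ I_{j−k}(2z) ]_{j,k=1,…,l} = 1 + Σ_{N=1}^∞ T_l(N) z^{2N}/(N!)². -/
open Real

/-- `T l N`: the number of permutations of `{1,…,N}` containing no increasing subsequence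
of length `l+1`. -/
noncomputable def numPermsLIS (l N : ℕ) : ℕ :=
  Nat.card {σ : Equiv.Perm (Fin N) //
    ¬ ∃ s : Fin (l + 1) → Fin N, StrictMono s ∧ StrictMono (fun t => σ (s t))}

noncomputable def ifac (m : ℤ) : ℝ := if 0 ≤ m then 1 / (m.toNat.factorial : ℝ) else 0

lemma ifac_step (m : ℤ) : (m : ℝ) * ifac m = ifac (m - 1) := by
  unfold ifac
  rcases lt_trichotomy m 0 with h | h | h
  · rw [if_neg (by omega), if_neg (by omega)]; simp
  · subst h; simp
  · obtain ⟨k, rfl⟩ : ∃ k : ℕ, m = k + 1 := ⟨(m - 1).toNat, by omega⟩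
    rw [if_pos (by omega), if_pos (by omega)]
    have h1 : ((k : ℤ) + 1).toNat = k + 1 := by omega
    have h2 : ((k : ℤ) + 1 - 1).toNat = k := by omega
    rw [h1, h2, Nat.factorial_succ]
    push_cast
    have : (k.factorial : ℝ) ≠ 0 := by positivity
    field_simp

noncomputable def bet {l : ℕ} (y : Fin l → ℤ) : ℝ :=
  Matrix.det (Matrix.of fun j i : Fin l => ifac (y i + (j : ℕ)))

lemma bet_rec {l : ℕ} (y : Fin l → ℤ) :
    ((∑ i, (y i + (i : ℕ)) : ℤ) : ℝ) * bet y
      = ∑ i, bet (Function.update y i (y i - 1)) := by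
  unfold bet
  simp only [Matrix.det_apply', Matrix.of_apply, Finset.mul_sum]
  rw [Finset.sum_comm]
  refine Finset.sum_congr rfl fun σ _ => ?_
  rw [← Finset.mul_sum, mul_left_comm]
  congr 1
  have h : (∑ i, (y i + (i : ℕ)) : ℤ) = ∑ i, (y i + ((σ i : Fin l) : ℕ)) := by
    rw [Finset.sum_add_distrib, Finset.sum_add_distrib]
    congr 1
    exact (Equiv.sum_comp σ (fun i : Fin l => ((i : ℕ) : ℤ))).symm
  rw [h]
  push_cast
  rw [Finset.sum_mul]
  refine Finset.sum_congr rfl fun i _ => ?_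
  rw [← Finset.mul_prod_erase _ _ (Finset.mem_univ i),
    ← Finset.mul_prod_erase _ (fun k => ifac (Function.update y i (y i - 1) k + _)) (Finset.mem_univ i), ← mul_assoc]
  congr 1
  · have := ifac_step (y i + ((σ i : Fin l) : ℕ))
    push_cast at this
    rw [this]
    simp
    congr 1
    ring
  · refine Finset.prod_congr rfl fun k hk => ?_
    rw [Function.update_of_ne (Finset.ne_of_mem_erase hk)]

lemma bet_swap {l : ℕ} (y : Fin l → ℤ) {i j : Fin l} (h : i ≠ j) :
    bet (y ∘ Equiv.swap i j) = - bet y := by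
  unfold bet
  have := Matrix.det_permute' (Equiv.swap i j) (Matrix.of fun j i : Fin l => ifac (y i + (j : ℕ)))
  rw [Equiv.Perm.sign_swap h] at this
  simpa [Matrix.submatrix, Matrix.of_apply] using this

lemma bet_zero {l : ℕ} (y : Fin l → ℤ) (i : Fin l) (h : y i + l ≤ 0) : bet y = 0 := by
  unfold bet
  apply Matrix.det_eq_zero_of_column_eq_zero i
  intro j
  rw [Matrix.of_apply]
  unfold ifac
  rw [if_neg]
  have := j.2
  omega

lemma bet_one {l : ℕ} : bet (fun i : Fin l => -((i : ℕ) : ℤ)) = 1 := by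
  unfold bet
  rw [Matrix.det_of_isLowerTriangular]
  · simp [ifac]
  · intro i j hij
    have : i < j := hij
    rw [Matrix.of_apply]
    unfold ifac
    rw [if_neg]
    rw [Fin.lt_def] at this
    beta_reduce
    omega

def Yv {n l : ℕ} (a : Fin n → Fin l) (i : Fin l) : ℤ :=
  (∑ t, if a t = i then 1 else 0) - ((i : ℕ) : ℤ)

def kp {n : ℕ} (κ : Fin (n + 1) → ℕ) (x : Fin (n + 1)) (t : Fin n) : ℕ :=
  if x < x.succAbove t then min (κ (x.succAbove t)) (κ x - 1) else κ (x.succAbove t)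

noncomputable def Gs {n : ℕ} (l : ℕ) (κ : Fin n → ℕ) : ℝ :=
  ∑ a : Fin n → Fin l, if ∀ t, (a t : ℕ) < κ t then bet (Yv a) else 0

lemma notP_zero {n l : ℕ} (κ : Fin n → ℕ) (hl : ∀ t, κ t ≤ l) (i : Fin l) :
    (∑ a : Fin n → Fin l, if (∀ t, (a t : ℕ) < κ t) ∧ ¬ (∃ t, a t = i ∧ κ t = i + 1)
      then bet (Function.update (Yv a) i (Yv a i - 1)) else 0) = 0 := by
  by_cases hi : (i : ℕ) + 1 < l
  · set j : Fin l := ⟨i + 1, hi⟩ with hj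
    have hij : i ≠ j := by
      intro h; have := congrArg Fin.val h; simp [hj] at this
    set f : (Fin n → Fin l) → ℝ := fun a => if (∀ t, (a t : ℕ) < κ t) ∧ ¬ (∃ t, a t = i ∧ κ t = i + 1)
      then bet (Function.update (Yv a) i (Yv a i - 1)) else 0 with hf
    have key : ∀ a : Fin n → Fin l, f (Equiv.swap i j ∘ a) = - f a := by
      have mono : ∀ a : Fin n → Fin l, ((∀ t, (a t : ℕ) < κ t) ∧ ¬ (∃ t, a t = i ∧ κ t = i + 1)) →
          ((∀ t, ((Equiv.swap i j ∘ a) t : ℕ) < κ t) ∧ ¬ (∃ t, (Equiv.swap i j ∘ a) t = i ∧ κ t = i + 1)) := by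
        rintro a ⟨h1, h2⟩
        constructor
        · intro t
          have := h1 t
          simp only [Function.comp]
          rcases eq_or_ne (a t) i with h | h
          · rw [h, Equiv.swap_apply_left]
            have h3 : κ t ≠ i + 1 := fun h' => h2 ⟨t, h, h'⟩
            rw [h] at this
            simp only [hj]
            omega
          · rcases eq_or_ne (a t) j with h' | h'
            · rw [h', Equiv.swap_apply_right]
              rw [h'] at this; simp only [hj] at this; omega
            · rwa [Equiv.swap_apply_of_ne_of_ne h h']
        · rintro ⟨t, h3, h4⟩
          have h5 : a t = j := by
            have := congrArg (Equiv.swap i j) h3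
            simpa using this
          have := h1 t
          rw [h5] at this; simp only [hj] at this; omega
      intro a
      simp only [hf]
      by_cases h : ((∀ t, (a t : ℕ) < κ t) ∧ ¬ (∃ t, a t = i ∧ κ t = i + 1))
      · rw [if_pos h, if_pos (mono a h), ← bet_swap _ hij]
        congr 1
        funext k
        have hc : ∀ k, (∑ t, if (Equiv.swap i j ∘ a) t = k then (1:ℤ) else 0)
            = ∑ t, if a t = Equiv.swap i j k then (1:ℤ) else 0 := by
          intro k
          refine Finset.sum_congr rfl fun t _ => ?_
          have : (Equiv.swap i j ∘ a) t = k ↔ a t = Equiv.swap i j k := by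
            simp only [Function.comp]
            constructor
            · intro h; rw [← h]; simp
            · intro h; rw [h]; simp
          simp only [this]
        simp only [Function.comp]
        rcases eq_or_ne k i with h1 | h1
        · subst h1
          rw [Equiv.swap_apply_left, Function.update_self, Function.update_of_ne hij.symm]
          unfold Yv
          rw [hc, Equiv.swap_apply_left]
          simp [hj]; ring
        · rcases eq_or_ne k j with h2 | h2
          · rw [h2, Equiv.swap_apply_right, Function.update_self, Function.update_of_ne hij.symm]
            unfold Yv
            rw [hc, Equiv.swap_apply_right]
            simp [hj]; ring
          · rw [Equiv.swap_apply_of_ne_of_ne h1 h2, Function.update_of_ne h1, Function.update_of_ne h1]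
            unfold Yv
            rw [hc, Equiv.swap_apply_of_ne_of_ne h1 h2]
      · rw [if_neg h, if_neg]
        · simp
        · intro h'
          apply h
          have := mono _ h'
          have e : Equiv.swap i j ∘ Equiv.swap i j ∘ a = a := by funext t; simp
          rwa [e] at this
    have e := Equiv.sum_comp (Equiv.arrowCongr (Equiv.refl (Fin n)) (Equiv.swap i j)) f
    have e2 : ∀ a, f (Equiv.arrowCongr (Equiv.refl (Fin n)) (Equiv.swap i j) a) = - f a := fun a => key a
    simp only [e2, Finset.sum_neg_distrib] at e
    linarith
  · apply Finset.sum_eq_zero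
    intro a _
    split_ifs with h
    · apply bet_zero _ i
      have : ∀ t, a t ≠ i := by
        intro t ht
        apply h.2
        refine ⟨t, ht, ?_⟩
        have h1 := h.1 t
        have h2 := hl t
        have := i.2
        rw [ht] at h1
        omega
      simp [Yv, this]
      omega
    · rfl

lemma P_sum {n l : ℕ} (κ : Fin (n + 1) → ℕ) (hκ : Antitone κ) (i : Fin l) :
    (∑ a : Fin (n + 1) → Fin l, if (∀ t, (a t : ℕ) < κ t) ∧ (∃ t, a t = i ∧ κ t = i + 1)
      then bet (Function.update (Yv a) i (Yv a i - 1)) else 0) =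
    ∑ x, if κ x = i + 1 then Gs l (kp κ x) else 0 := by
  have h1 : ∀ a : Fin (n + 1) → Fin l, (if (∀ t, (a t : ℕ) < κ t) ∧ (∃ t, a t = i ∧ κ t = i + 1)
      then bet (Function.update (Yv a) i (Yv a i - 1)) else 0) =
      ∑ x, if (∀ t, (a t : ℕ) < κ t) ∧ (a x = i ∧ κ x = i + 1) ∧ ∀ t, x < t → ¬ (a t = i ∧ κ t = i + 1)
        then bet (Function.update (Yv a) i (Yv a i - 1)) else 0 := by
    intro a
    split_ifs with h
    · obtain ⟨h1, h2⟩ := h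
      let S := Finset.univ.filter (fun t => a t = i ∧ κ t = i + 1)
      have hS : S.Nonempty := by
        obtain ⟨t, ht⟩ := h2; exact ⟨t, by simp [S, ht]⟩
      have hm := S.max'_mem hS
      rw [Finset.sum_eq_single (S.max' hS), if_pos]
      · refine ⟨h1, by simpa [S] using hm, ?_⟩
        intro t ht hh
        exact absurd (S.le_max' t (by simpa [S] using hh)) (not_le.mpr ht)
      · intro b _ hb
        rw [if_neg]
        rintro ⟨-, h3, h4⟩
        have : b ≤ S.max' hS := S.le_max' b (by simpa [S] using h3)
        exact h4 _ (lt_of_le_of_ne this hb) (by simpa [S] using hm)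
      · simp
    · symm
      apply Finset.sum_eq_zero
      intro x _
      rw [if_neg]
      rintro ⟨h1, h2, -⟩
      exact h ⟨h1, x, h2⟩
  rw [Finset.sum_congr rfl (fun a _ => h1 a), Finset.sum_comm]
  refine Finset.sum_congr rfl fun x _ => ?_
  by_cases hx : κ x = i + 1
  · rw [if_pos hx, ← (Fin.insertNthEquiv (fun _ => Fin l) x).sum_comp, Fintype.sum_prod_type,
      Finset.sum_eq_single i]
    · unfold Gs
      refine Finset.sum_congr rfl fun a _ => ?_
      simp only [Fin.insertNthEquiv_apply]
      have hY : Function.update (Yv (x.insertNth (α := fun _ => Fin l) i a)) i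
          (Yv (x.insertNth (α := fun _ => Fin l) i a) i - 1) = Yv a := by
        funext k
        rcases eq_or_ne k i with h | h
        · subst h
          simp [Yv, Fin.sum_univ_succAbove _ x]; ring
        · rw [Function.update_of_ne h]
          simp [Yv, Fin.sum_univ_succAbove _ x, h.symm]
      change (if _ then bet (Function.update (Yv (x.insertNth (α := fun _ => Fin l) i a)) i
          (Yv (x.insertNth (α := fun _ => Fin l) i a) i - 1)) else 0) = _
      rw [hY]
      congr 1
      apply propext
      constructor
      · rintro ⟨h1, -, h3⟩ t
        have := h1 (x.succAbove t)
        rw [Fin.insertNth_apply_succAbove] at this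
        unfold kp
        split_ifs with h
        · have h4 := h3 _ h
          rw [Fin.insertNth_apply_succAbove] at h4
          have h5 := hκ h.le
          have h6 : (a t : ℕ) ≠ i ∨ κ (x.succAbove t) ≠ i + 1 := by
            by_contra hh; push Not at hh; exact h4 ⟨Fin.ext hh.1, hh.2⟩
          omega
        · exact this
      · intro h
        refine ⟨?_, ⟨by simp, hx⟩, ?_⟩
        · intro t
          rcases Fin.eq_self_or_eq_succAbove x t with rfl | ⟨t, rfl⟩
          · simp [hx]
          · rw [Fin.insertNth_apply_succAbove]
            have := h t
            unfold kp at this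
            split_ifs at this <;> omega
        · intro t ht
          rcases Fin.eq_self_or_eq_succAbove x t with rfl | ⟨t, rfl⟩
          · exact absurd ht (lt_irrefl _)
          · rw [Fin.insertNth_apply_succAbove]
            have := h t
            unfold kp at this
            rw [if_pos ht] at this
            rintro ⟨rfl, h7⟩
            omega
    · intro j _ hj
      apply Finset.sum_eq_zero
      intro a _
      rw [if_neg]
      rintro ⟨-, ⟨h, -⟩, -⟩
      simp at h
      exact hj h
    · simp
  · rw [if_neg hx]
    apply Finset.sum_eq_zero
    intro a _
    rw [if_neg]
    tauto

lemma Yv_sum {n l : ℕ} (a : Fin n → Fin l) : (∑ i, (Yv a i + (i : ℕ))) = n := by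
  simp only [Yv, sub_add_cancel]
  rw [Finset.sum_comm]
  simp

lemma Gs_rec {n l : ℕ} (κ : Fin (n + 1) → ℕ) (hκ : Antitone κ) (hl : ∀ t, κ t ≤ l) :
    ((n + 1 : ℕ) : ℝ) * Gs l κ = ∑ x, if κ x = 0 then 0 else Gs l (kp κ x) := by
  have h1 : ((n + 1 : ℕ) : ℝ) * Gs l κ = ∑ i : Fin l, ∑ a : Fin (n + 1) → Fin l,
      if ∀ t, (a t : ℕ) < κ t then bet (Function.update (Yv a) i (Yv a i - 1)) else 0 := by
    rw [Finset.sum_comm]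
    unfold Gs
    rw [Finset.mul_sum]
    refine Finset.sum_congr rfl fun a _ => ?_
    split_ifs
    · have := bet_rec (Yv a)
      rw [Yv_sum] at this
      exact_mod_cast this
    · simp
  have h2 : ∀ i : Fin l, (∑ a : Fin (n + 1) → Fin l,
      if ∀ t, (a t : ℕ) < κ t then bet (Function.update (Yv a) i (Yv a i - 1)) else 0)
      = ∑ x, if κ x = i + 1 then Gs l (kp κ x) else 0 := by
    intro i
    rw [← P_sum κ hκ i]
    refine Eq.trans ?_ ((congrArg₂ (· + ·) rfl (notP_zero κ hl i)).trans (add_zero _))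
    rw [← Finset.sum_add_distrib]
    refine Finset.sum_congr rfl fun a _ => ?_
    by_cases h : ∀ t, (a t : ℕ) < κ t <;> by_cases h' : ∃ t, a t = i ∧ κ t = i + 1
    · rw [if_pos h, if_pos ⟨h, h'⟩, if_neg (fun hh => hh.2 h'), add_zero]
    · rw [if_pos h, if_neg (fun hh => h' hh.2), if_pos ⟨h, h'⟩, zero_add]
    · rw [if_neg h, if_neg (by tauto), if_neg (by tauto), add_zero]
    · rw [if_neg h, if_neg (by tauto), if_neg (by tauto), add_zero]
  rw [h1, Finset.sum_congr rfl (fun i _ => h2 i), Finset.sum_comm]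
  refine Finset.sum_congr rfl fun x _ => ?_
  split_ifs with h
  · apply Finset.sum_eq_zero
    intro i _
    rw [if_neg (by omega)]
  · have := hl x
    rw [Finset.sum_eq_single (⟨κ x - 1, by omega⟩ : Fin l)]
    · rw [if_pos]; simp; omega
    · intro i _ hi
      rw [if_neg]
      intro h'
      apply hi
      ext; simp; omega
    · simp

def Good {n : ℕ} (κ : Fin n → ℕ) (σ : Equiv.Perm (Fin n)) : Prop :=
  ∀ S : Finset (Fin n), S.Nonempty → StrictMonoOn σ S → ∃ i ∈ S, S.card ≤ κ (σ i)

open Classical in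
noncomputable def gc {n : ℕ} (κ : Fin n → ℕ) : ℝ :=
  ∑ σ : Equiv.Perm (Fin n), if Good κ σ then 1 else 0

def ins {n : ℕ} (x : Fin (n + 1)) (τ : Equiv.Perm (Fin n)) : Equiv.Perm (Fin (n + 1)) :=
  (finSuccEquiv' 0).trans ((Equiv.optionCongr τ).trans (finSuccEquiv' x).symm)

lemma ins_zero {n : ℕ} (x : Fin (n + 1)) (τ : Equiv.Perm (Fin n)) : ins x τ 0 = x := by
  simp [ins]

lemma ins_succ {n : ℕ} (x : Fin (n + 1)) (τ : Equiv.Perm (Fin n)) (i : Fin n) :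
    ins x τ i.succ = x.succAbove (τ i) := by
  have : finSuccEquiv' (0 : Fin (n + 1)) i.succ = some i := by
    rw [← Fin.succAbove_zero, finSuccEquiv'_succAbove]
  simp [ins, this]

lemma ins_bij {n : ℕ} : Function.Bijective
    (fun p : Fin (n + 1) × Equiv.Perm (Fin n) => ins p.1 p.2) := by
  rw [Fintype.bijective_iff_injective_and_card]
  constructor
  · rintro ⟨x, τ⟩ ⟨x', τ'⟩ h
    simp only at h
    have h0 : x = x' := by rw [← ins_zero x τ, h, ins_zero]
    subst h0
    congr 1
    ext i
    have := congrArg (fun e => e i.succ) h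
    simp only [ins_succ] at this
    rw [Fin.succAbove_right_injective this]
  · simp [Fintype.card_perm, Nat.factorial_succ]

lemma kp_le {n : ℕ} (κ : Fin (n + 1) → ℕ) (x : Fin (n + 1)) (t : Fin n) :
    kp κ x t ≤ κ (x.succAbove t) := by
  unfold kp; split_ifs
  · exact min_le_left _ _
  · exact le_rfl

lemma kp_anti {n : ℕ} (κ : Fin (n + 1) → ℕ) (hκ : Antitone κ) (x : Fin (n + 1)) :
    Antitone (kp κ x) := by
  intro s t hst
  have h1 : x.succAbove s ≤ x.succAbove t := (Fin.strictMono_succAbove x).monotone hst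
  have h2 := hκ h1
  unfold kp
  by_cases hs : x < x.succAbove s
  · rw [if_pos hs, if_pos (lt_of_lt_of_le hs h1)]; omega
  · rw [if_neg hs]; split_ifs <;> omega

lemma good_ins {n : ℕ} (κ : Fin (n + 1) → ℕ) (hκ : Antitone κ) (x : Fin (n + 1))
    (τ : Equiv.Perm (Fin n)) : Good κ (ins x τ) ↔ κ x ≠ 0 ∧ Good (kp κ x) τ := by
  have hsm := Fin.strictMono_succAbove x
  have hmap : ∀ S : Finset (Fin n), StrictMonoOn τ S →
      StrictMonoOn (ins x τ) ((S.map (Fin.succEmb n) : Finset _) : Set (Fin (n + 1))) := by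
    intro S hS a ha b hb hab
    simp only [Finset.coe_map, Set.mem_image, Fin.coe_succEmb] at ha hb
    obtain ⟨a, ha, rfl⟩ := ha
    obtain ⟨b, hb, rfl⟩ := hb
    rw [ins_succ, ins_succ]
    exact hsm (hS ha hb (Fin.succ_lt_succ_iff.mp hab))
  constructor
  · intro h
    constructor
    · obtain ⟨i, hi, h1⟩ := h {0} (by simp) (by simp)
      simp only [Finset.mem_singleton] at hi
      subst hi
      rw [ins_zero] at h1
      simp at h1
      omega
    · intro S hS hmono
      have hm := S.min'_mem hS
      refine ⟨S.min' hS, hm, ?_⟩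
      have hmin : ∀ j ∈ S, τ (S.min' hS) ≤ τ j := fun j hj =>
        hmono.monotoneOn hm hj (S.min'_le j hj)
      have h1 : S.card ≤ κ (x.succAbove (τ (S.min' hS))) := by
        obtain ⟨i, hi, h1⟩ := h (S.map (Fin.succEmb n)) (by simpa using hS) (hmap S hmono)
        simp only [Finset.mem_map, Fin.coe_succEmb] at hi
        obtain ⟨j, hj, rfl⟩ := hi
        rw [ins_succ, Finset.card_map] at h1
        exact h1.trans (hκ (hsm.monotone (hmin j hj)))
      unfold kp
      split_ifs with hx
      · refine le_min h1 ?_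
        have h0 : (0 : Fin (n + 1)) ∉ S.map (Fin.succEmb n) := by simp [Fin.succ_ne_zero]
        obtain ⟨i, hi, h2⟩ := h (insert 0 (S.map (Fin.succEmb n))) (by simp) (by
          intro a ha b hb hab
          rw [Finset.coe_insert] at ha hb
          rcases hb with rfl | hb
          · exact absurd hab (by simp)
          rcases ha with rfl | ha
          · simp only [Finset.coe_map, Set.mem_image, Fin.coe_succEmb] at hb
            obtain ⟨b, hb, rfl⟩ := hb
            rw [ins_zero, ins_succ]
            exact lt_of_lt_of_le hx (hsm.monotone (hmin b hb))
          · exact hmap S hmono ha hb hab)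
        rw [Finset.card_insert_of_notMem h0, Finset.card_map] at h2
        have h3 : κ (ins x τ i) ≤ κ x := by
          apply hκ
          rcases Finset.mem_insert.mp hi with rfl | hi
          · rw [ins_zero]
          · simp only [Finset.mem_map, Fin.coe_succEmb] at hi
            obtain ⟨j, hj, rfl⟩ := hi
            rw [ins_succ]
            exact (lt_of_lt_of_le hx (hsm.monotone (hmin j hj))).le
        omega
      · exact h1
  · rintro ⟨hx, h⟩ S hS hmono
    let S' : Finset (Fin n) := Finset.univ.filter (fun i => i.succ ∈ S)
    have hS' : S'.map (Fin.succEmb n) = S.erase 0 := by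
      ext i
      refine Fin.cases ?_ (fun i => ?_) i
      · simp [Fin.succ_ne_zero]
      · simp [S', Fin.succ_ne_zero]
    have hm' : StrictMonoOn τ S' := by
      intro a ha b hb hab
      have ha' : a.succ ∈ S := by simpa [S'] using ha
      have hb' : b.succ ∈ S := by simpa [S'] using hb
      have := hmono ha' hb' (Fin.succ_lt_succ_iff.mpr hab)
      rw [ins_succ, ins_succ] at this
      exact hsm.lt_iff_lt.mp this
    have hc := congrArg Finset.card hS'
    rw [Finset.card_map] at hc
    by_cases h0 : (0 : Fin (n + 1)) ∈ S
    · refine ⟨0, h0, ?_⟩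
      rw [ins_zero]
      rw [Finset.card_erase_of_mem h0] at hc
      rcases S'.eq_empty_or_nonempty with he | hne
      · rw [he] at hc; simp at hc; omega
      · obtain ⟨i, hi, h1⟩ := h S' hne hm'
        have hi' : i.succ ∈ S := by simpa [S'] using hi
        have := hmono h0 hi' (Fin.succ_pos i)
        rw [ins_zero, ins_succ] at this
        unfold kp at h1
        rw [if_pos this] at h1
        omega
    · rw [Finset.erase_eq_of_notMem h0] at hc hS'
      have hne : S'.Nonempty := by
        rw [← Finset.card_pos, hc, Finset.card_pos]; exact hS
      obtain ⟨i, hi, h1⟩ := h S' hne hm'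
      have hi' : i.succ ∈ S := by simpa [S'] using hi
      refine ⟨i.succ, hi', ?_⟩
      rw [ins_succ, ← hc]
      exact h1.trans (kp_le κ x _)

lemma gc_rec {n : ℕ} (κ : Fin (n + 1) → ℕ) (hκ : Antitone κ) :
    gc κ = ∑ x, if κ x = 0 then 0 else gc (kp κ x) := by
  classical
  unfold gc
  rw [← (Equiv.ofBijective _ ins_bij).sum_comp, Fintype.sum_prod_type]
  refine Finset.sum_congr rfl fun x _ => ?_
  simp only [Equiv.ofBijective_apply, good_ins κ hκ]
  split_ifs with h
  · simp [h]
  · simp [h]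

lemma gc_const (l N : ℕ) : gc (fun _ : Fin N => l) =
    (Nat.card {σ : Equiv.Perm (Fin N) //
    ¬ ∃ s : Fin (l + 1) → Fin N, StrictMono s ∧ StrictMono (fun t => σ (s t))} : ℝ) := by
  classical
  unfold gc
  rw [Finset.sum_boole, Nat.card_eq_fintype_card, Fintype.card_subtype]
  congr 2
  ext σ
  simp only [Finset.mem_filter, Finset.mem_univ, true_and]
  constructor
  · rintro h ⟨s, h1, h2⟩
    obtain ⟨i, -, hi⟩ := h (Finset.univ.map ⟨s, h1.injective⟩) (by simp) (by
      intro a ha b hb hab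
      simp at ha hb
      obtain ⟨a, rfl⟩ := ha
      obtain ⟨b, rfl⟩ := hb
      exact h2 (h1.lt_iff_lt.mp hab))
    simp at hi
  · intro h S hS hm
    obtain ⟨i, hi⟩ := hS
    refine ⟨i, hi, ?_⟩
    by_contra hlt
    push Not at hlt
    obtain ⟨S', hS', hcard⟩ := Finset.exists_subset_card_eq (show l + 1 ≤ S.card from hlt)
    apply h
    refine ⟨S'.orderEmbOfFin hcard, (S'.orderEmbOfFin hcard).strictMono, ?_⟩
    intro a b hab
    exact hm (hS' (Finset.orderEmbOfFin_mem _ _ _)) (hS' (Finset.orderEmbOfFin_mem _ _ _))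
      ((S'.orderEmbOfFin hcard).strictMono hab)

lemma hasSum_prod_fin : ∀ (l : ℕ) (f : Fin l → ℕ → ℝ) (_ : ∀ i, Summable (fun k => ‖f i k‖)),
    Summable (fun c : Fin l → ℕ => ‖∏ i, f i (c i)‖) ∧
    HasSum (fun c : Fin l → ℕ => ∏ i, f i (c i)) (∏ i, ∑' k, f i k) := by
  intro l
  induction l with
  | zero =>
    intro f _
    constructor
    · exact (hasSum_fintype _).summable
    · simp
  | succ l ih =>
    intro f hf
    obtain ⟨h1, h2⟩ := ih (fun i => f i.succ) (fun i => hf i.succ)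
    have hs := summable_mul_of_summable_norm (hf 0) h1
    have hsn := (hf 0).mul_norm h1
    have hm := (hf 0).of_norm.hasSum.mul h2 hs
    constructor
    · rw [← (Fin.consEquiv (fun _ => ℕ)).summable_iff]
      convert hsn using 1
      funext p
      simp [Fin.consEquiv, Fin.prod_univ_succ]
    · rw [← (Fin.consEquiv (fun _ => ℕ)).hasSum_iff, Fin.prod_univ_succ]
      refine (congrArg (fun g => HasSum g _) ?_).mpr hm
      funext p
      simp [Fin.consEquiv, Fin.prod_univ_succ]

noncomputable def ft (z : ℝ) (d : ℤ) (k : ℕ) : ℝ :=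
  z ^ (d + 2 * k).toNat * ifac (d + k) / (k.factorial : ℝ)

lemma ifac_bd (m : ℤ) : 0 ≤ ifac m ∧ ifac m ≤ 1 := by
  unfold ifac
  split_ifs
  · refine ⟨by positivity, ?_⟩
    rw [div_le_one (by positivity)]
    exact_mod_cast Nat.one_le_iff_ne_zero.mpr (Nat.factorial_ne_zero _)
  · simp

lemma ft_summable (z : ℝ) (d : ℤ) : Summable (fun k => ‖ft z d k‖) := by
  set M := max 1 |z|
  have hM : 1 ≤ M := le_max_left _ _
  refine Summable.of_nonneg_of_le (fun _ => norm_nonneg _) (fun k => ?_)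
    ((Real.summable_pow_div_factorial (M ^ 2)).mul_left (M ^ d.natAbs))
  unfold ft
  obtain ⟨h0, h1⟩ := ifac_bd (d + k)
  rw [norm_div, norm_mul, norm_pow, Real.norm_eq_abs, Real.norm_eq_abs, abs_of_nonneg h0,
    Real.norm_eq_abs, Nat.abs_cast, ← mul_div_assoc]
  refine div_le_div_of_nonneg_right ?_ (by positivity)
  calc |z| ^ (d + 2 * k).toNat * ifac (d + k) ≤ M ^ (d + 2 * k).toNat * 1 := by
        gcongr
        exact le_max_right _ _
    _ ≤ M ^ (d.natAbs + 2 * k) := by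
        rw [mul_one]
        exact pow_le_pow_right₀ hM (by omega)
    _ = _ := by rw [pow_add, pow_mul]

lemma bessel_eq (z : ℝ) (d : ℤ) : besselI (d : ℝ) (2 * z) = ∑' k, ft z d k := by
  unfold besselI ft
  refine tsum_congr fun k => ?_
  rw [mul_div_cancel_left₀ z (two_ne_zero)]
  unfold ifac
  split_ifs with h
  · obtain ⟨m, hm⟩ := Int.eq_ofNat_of_zero_le h
    have e1 : (d : ℝ) + k + 1 = (m : ℝ) + 1 := by
      have : ((d + k : ℤ) : ℝ) = ((m : ℤ) : ℝ) := by rw [hm]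
      push_cast at this; rw [this]
    have e2 : (d : ℝ) + 2 * k = ((d + 2 * k).toNat : ℝ) := by
      have : (((d + 2 * k).toNat : ℤ) : ℝ) = ((d + 2 * k : ℤ) : ℝ) := by
        rw [Int.toNat_of_nonneg (by omega)]
      push_cast at this
      rw [← this]
    rw [e1, e2, Real.Gamma_nat_eq_factorial, Real.rpow_natCast, hm]
    simp
    field_simp
  · obtain ⟨m, hm⟩ : ∃ m : ℕ, d + k + 1 = -(m : ℤ) := ⟨(-(d + k + 1)).toNat, by omega⟩
    have e1 : (d : ℝ) + k + 1 = -(m : ℝ) := by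
      exact_mod_cast hm
    rw [e1, Real.Gamma_neg_nat_eq_zero]
    simp

noncomputable def Hc {l : ℕ} (z : ℝ) (c : Fin l → ℕ) : ℝ :=
  z ^ (2 * ∑ i, c i) * (bet (fun i => (c i : ℤ) - ((i : ℕ) : ℤ)) / ∏ i, ((c i).factorial : ℝ))

lemma Hc_eq {l : ℕ} (z : ℝ) (c : Fin l → ℕ) : Hc z c =
    ∑ σ : Equiv.Perm (Fin l), ((Equiv.Perm.sign σ : ℤ) : ℝ) *
      ∏ i, ft z (((σ i : Fin l) : ℕ) - ((i : ℕ) : ℤ)) (c i) := by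
  unfold Hc bet ft
  rw [Matrix.det_apply', Finset.sum_div, Finset.mul_sum]
  refine Finset.sum_congr rfl fun σ _ => ?_
  simp only [Matrix.of_apply]
  rw [Finset.prod_div_distrib, mul_div_assoc, mul_left_comm]
  congr 1
  rw [← mul_div_assoc]
  congr 1
  have e : ∀ i : Fin l, (c i : ℤ) - ((i : ℕ) : ℤ) + (((σ i : Fin l) : ℕ) : ℤ)
      = (((σ i : Fin l) : ℕ) : ℤ) - ((i : ℕ) : ℤ) + (c i : ℤ) := fun i => by ring
  simp only [e]
  rw [Finset.prod_mul_distrib]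
  by_cases h : ∀ i : Fin l, 0 ≤ (((σ i : Fin l) : ℕ) : ℤ) - ((i : ℕ) : ℤ) + (c i : ℤ)
  · congr 1
    rw [Finset.prod_pow_eq_pow_sum]
    congr 1
    zify
    have : ∀ i : Fin l, (((((σ i : Fin l) : ℕ) : ℤ) - ((i : ℕ) : ℤ) + 2 * (c i : ℤ)).toNat : ℤ)
        = (((σ i : Fin l) : ℕ) : ℤ) - ((i : ℕ) : ℤ) + 2 * (c i : ℤ) := by
      intro i
      have := h i
      omega
    rw [Finset.sum_congr rfl (fun i _ => this i), Finset.sum_add_distrib, Finset.sum_sub_distrib,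
      Equiv.sum_comp σ (fun i : Fin l => ((i : ℕ) : ℤ)), sub_self, zero_add, Finset.mul_sum]
  · push Not at h
    obtain ⟨i, hi⟩ := h
    have : (∏ i : Fin l, ifac ((((σ i : Fin l) : ℕ) : ℤ) - ((i : ℕ) : ℤ) + (c i : ℤ))) = 0 := by
      apply Finset.prod_eq_zero (Finset.mem_univ i)
      unfold ifac
      rw [if_neg (by omega)]
    rw [this, mul_zero, mul_zero]

lemma hasSum_det (l : ℕ) (z : ℝ) : HasSum (fun c : Fin l → ℕ => Hc z c)
    (Matrix.det (Matrix.of fun j k : Fin l =>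
      besselI (((j : ℕ) : ℝ) - ((k : ℕ) : ℝ)) (2 * z))) := by
  rw [Matrix.det_apply']
  simp only [Hc_eq, Matrix.of_apply]
  apply hasSum_sum
  intro σ _
  apply HasSum.mul_left
  have := (hasSum_prod_fin l (fun i => ft z (((σ i : Fin l) : ℕ) - ((i : ℕ) : ℤ)))
    (fun i => ft_summable _ _)).2
  refine (congrArg (HasSum _) ?_).mpr this
  refine Finset.prod_congr rfl fun i _ => ?_
  rw [← bessel_eq]
  push_cast
  rfl

lemma hasSum_grade {l : ℕ} (f : (Fin l → ℕ) → ℝ) (s : ℝ) (h : HasSum f s) :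
    HasSum (fun N => ∑ c ∈ Finset.piAntidiag Finset.univ N, f c) s := by
  let e : (Σ N : ℕ, ↥(Finset.piAntidiag (Finset.univ : Finset (Fin l)) N)) ≃ (Fin l → ℕ) :=
    { toFun := fun p => p.2.1
      invFun := fun c => ⟨∑ i, c i, c, by simp⟩
      left_inv := by
        rintro ⟨N, c, hc⟩
        have : ∑ i, c i = N := by simpa using hc
        subst this
        rfl
      right_inv := fun c => rfl }
  rw [← e.hasSum_iff] at h
  refine h.sigma fun N => ?_
  exact Finset.hasSum (Finset.piAntidiag Finset.univ N) f

def cn {N l : ℕ} (a : Fin N → Fin l) (i : Fin l) : ℕ := ∑ t, if a t = i then 1 else 0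

lemma group (l N : ℕ) : ∀ F : (Fin l → ℕ) → ℝ,
    (N.factorial : ℝ) * ∑ c ∈ Finset.piAntidiag Finset.univ N, F c / ∏ i, ((c i).factorial : ℝ)
    = ∑ a : Fin N → Fin l, F (cn a) := by
  induction N with
  | zero =>
    intro F
    have : ∀ a : Fin 0 → Fin l, cn a = 0 := by intro a; funext i; simp [cn]
    simp [this]
  | succ N ih =>
    intro F
    have h1 : ((N + 1 : ℕ) : ℝ) * ∑ c ∈ Finset.piAntidiag Finset.univ (N + 1), F c / ∏ i, ((c i).factorial : ℝ)
        = ∑ i : Fin l, ∑ c ∈ Finset.piAntidiag Finset.univ N, F (c + Pi.single i 1) / ∏ i, ((c i).factorial : ℝ) := by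
      have h2 : ∀ i : Fin l, ∑ c ∈ Finset.piAntidiag Finset.univ N, F (c + Pi.single i 1) / ∏ i, ((c i).factorial : ℝ)
          = ∑ c ∈ Finset.piAntidiag Finset.univ (N + 1), (c i : ℝ) * (F c / ∏ i, ((c i).factorial : ℝ)) := by
        intro i
        rw [← Finset.sum_filter_of_ne (s := Finset.piAntidiag Finset.univ (N + 1)) (p := fun c : Fin l → ℕ => c i ≠ 0)]
        · refine Finset.sum_nbij' (fun c => c + Pi.single i 1) (fun c => c - Pi.single i 1) ?_ ?_ ?_ ?_ ?_
          · intro c hc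
            simp [Finset.sum_add_distrib] at hc ⊢
            exact hc
          · intro c hc
            simp at hc ⊢
            have hle : ∀ j ∈ Finset.univ, (Pi.single i 1 : Fin l → ℕ) j ≤ c j := by
              intro j _
              rcases eq_or_ne j i with rfl | h
              · simp; omega
              · simp [h]
            rw [Finset.sum_tsub_distrib _ hle, hc.1]
            simp
          · intro c _
            simp
          · intro c hc
            simp at hc
            funext j
            rcases eq_or_ne j i with rfl | h
            · simp; omega
            · simp [h]
          · intro c _
            change F (c + Pi.single i 1) / (∏ j, ((c j).factorial : ℝ))
              = (((c + Pi.single i 1 : Fin l → ℕ) i : ℕ) : ℝ) * (F (c + Pi.single i 1) /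
                (∏ j, (((c + Pi.single i 1 : Fin l → ℕ) j).factorial : ℝ)))
            have q1 := (Finset.mul_prod_erase Finset.univ (fun j => ((c j).factorial : ℝ))
              (Finset.mem_univ i)).symm
            have q2 : ∏ j, (((c + Pi.single i 1 : Fin l → ℕ) j).factorial : ℝ)
              = (((c + Pi.single i 1 : Fin l → ℕ) i).factorial : ℝ) *
                ∏ j ∈ Finset.univ.erase i, (((c + Pi.single i 1 : Fin l → ℕ) j).factorial : ℝ) :=
              (Finset.mul_prod_erase Finset.univ _ (Finset.mem_univ i)).symm
            rw [q1, q2]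
            have : ∏ j ∈ Finset.univ.erase i, (((c + Pi.single i 1 : Fin l → ℕ) j).factorial : ℝ)
                = ∏ j ∈ Finset.univ.erase i, ((c j).factorial : ℝ) := by
              refine Finset.prod_congr rfl fun j hj => ?_
              simp [Finset.ne_of_mem_erase hj]
            rw [this]
            have hp : (∏ j ∈ Finset.univ.erase i, ((c j).factorial : ℝ)) ≠ 0 :=
              Finset.prod_ne_zero_iff.mpr fun j _ => by positivity
            simp [Nat.factorial_succ]
            field_simp
        · intro c _ h hc
          apply h; simp [hc]
      rw [Finset.sum_congr rfl (fun i _ => h2 i), Finset.sum_comm, Finset.mul_sum]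
      refine Finset.sum_congr rfl fun c hc => ?_
      rw [← Finset.sum_mul]
      congr 1
      have : ∑ i, c i = N + 1 := by simpa using hc
      rw [← this]
      push_cast
      rfl
    rw [Nat.factorial_succ, mul_comm (N + 1), Nat.cast_mul, mul_assoc, h1, Finset.mul_sum]
    refine (Finset.sum_congr rfl (fun i _ => ih (fun c => F (c + Pi.single i 1)))).trans ?_
    rw [← (Fin.consEquiv (fun _ => Fin l)).sum_comp, Fintype.sum_prod_type]
    refine Finset.sum_congr rfl fun i _ => Finset.sum_congr rfl fun a _ => ?_
    congr 1
    funext j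
    simp only [cn, Fin.consEquiv, Equiv.coe_fn_mk, Fin.sum_univ_succ, Fin.cons_zero, Fin.cons_succ,
      Pi.add_apply, Pi.single_apply]
    rw [add_comm]
    congr 1
    simp only [eq_comm]

lemma main_count {l : ℕ} : ∀ (n : ℕ) (κ : Fin n → ℕ), Antitone κ → (∀ t, κ t ≤ l) →
    gc κ = (n.factorial : ℝ) * Gs l κ := by
  intro n
  induction n with
  | zero =>
    intro κ _ _
    have h1 : gc κ = 1 := by
      unfold gc
      rw [Finset.sum_congr rfl (fun σ _ => if_pos ?_)]
      · simp
      · intro S hS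
        obtain ⟨i, -⟩ := hS
        exact i.elim0
    have h2 : Gs l κ = 1 := by
      unfold Gs
      rw [Fintype.sum_unique, if_pos (fun t => t.elim0), ← bet_one (l := l)]
      congr 1
      funext i
      simp [Yv]
    rw [h1, h2]; simp
  | succ n ih =>
    intro κ hκ hl
    rw [gc_rec κ hκ, Nat.factorial_succ, mul_comm (n + 1), Nat.cast_mul, mul_assoc,
      Gs_rec κ hκ hl, Finset.mul_sum]
    refine Finset.sum_congr rfl fun x _ => ?_
    split_ifs
    · simp
    · exact ih _ (kp_anti κ hκ x) (fun t => (kp_le κ x t).trans (hl _))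

lemma grade_eq (l N : ℕ) (z : ℝ) :
    ∑ c ∈ Finset.piAntidiag (Finset.univ : Finset (Fin l)) N, Hc z c
      = (numPermsLIS l N : ℝ) * z ^ (2 * N) / (N.factorial : ℝ) ^ 2 := by
  have h1 : (numPermsLIS l N : ℝ) = (N.factorial : ℝ) * Gs l (fun _ : Fin N => l) := by
    rw [← main_count N (fun _ => l) (fun _ _ _ => le_rfl) (fun _ => le_rfl), gc_const]
    rfl
  have h2 := group l N (fun c => bet (fun i => (c i : ℤ) - ((i : ℕ) : ℤ)))
  have h3 : Gs l (fun _ : Fin N => l)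
      = ∑ a : Fin N → Fin l, bet (fun i => (cn a i : ℤ) - ((i : ℕ) : ℤ)) := by
    unfold Gs
    refine Finset.sum_congr rfl fun a _ => ?_
    rw [if_pos (fun t => (a t).2)]
    congr 1
    funext i
    simp [Yv, cn]
  have h4 : ∑ c ∈ Finset.piAntidiag (Finset.univ : Finset (Fin l)) N, Hc z c
      = z ^ (2 * N) * ∑ c ∈ Finset.piAntidiag (Finset.univ : Finset (Fin l)) N,
        bet (fun i => (c i : ℤ) - ((i : ℕ) : ℤ)) / ∏ i, ((c i).factorial : ℝ) := by
    rw [Finset.mul_sum]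
    refine Finset.sum_congr rfl fun c hc => ?_
    have : ∑ i, c i = N := by simpa using hc
    unfold Hc
    rw [this]
  rw [h4, h1, h3, ← h2]
  have : (N.factorial : ℝ) ≠ 0 := by positivity
  field_simp

lemma numPermsLIS_zero (l : ℕ) : numPermsLIS l 0 = 1 := by
  unfold numPermsLIS
  rw [Nat.card_eq_one_iff_unique]
  refine ⟨inferInstance, ⟨1, ?_⟩⟩
  rintro ⟨s, -⟩
  exact (s 0).elim0

/-- Gessel's identity: `det[I_{j-k}(2z)]_{j,k=1,…,l} = 1 + Σ_{N≥1} T_l(N) z^{2N}/(N!)²`. -/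
theorem gessel_identity (l : ℕ) (hl : 1 ≤ l) (z : ℝ) :
    Matrix.det (fun j k : Fin l => besselI (((j : ℕ) : ℝ) - ((k : ℕ) : ℝ)) (2 * z))
    = 1 + ∑' N : ℕ,
        (numPermsLIS l (N + 1) : ℝ) * z ^ (2 * (N + 1)) / ((N + 1).factorial : ℝ) ^ 2 := by
  have h := hasSum_grade _ _ (hasSum_det l z)
  simp only [grade_eq] at h
  have h2 := h.summable.tsum_eq_zero_add
  rw [h.tsum_eq, numPermsLIS_zero] at h2
  simp only [Nat.cast_one, mul_zero, pow_zero, mul_one, Nat.factorial_zero, one_pow, div_one] at h2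
  exact h2
end
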